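/- arXiv:math/0504547 — 3 statements merged into one kernel-verified Lean document; each statement's English description precedes it below -/
import Mathlib

section
/- Let (Q,I) be a gentle quiver over a field K, let Sp be an admissible set of special vertices, let (Q̂, Î) be the covering skewed-gentle quiver, and let Â = KQ̂/Î be the corresponding skewed-gentle algebra. For each k ≥ 1 let c_k denote the number of minimal oriented k-cycles in Q with full zero relations. Then the q-Cartan matrix C_Â(q) is unimodularly equivalent over ℤ[q] to a diagonal matrix whose diagonal entries are 1 − (−q)^k with multiplicity c_k for each k ≥ 1, and all further diagonal entries equal to 1. -/
/-! Combinatorial model of a finite quiver with (quadratic monomial) relations.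

For a monomial algebra `A = KQ/I` (with `I` generated by paths of length 2),
a basis of `e_i A e_j` is given by the paths from `i` to `j` avoiding the
relations, so all Cartan-type invariants are encoded combinatorially. -/

/-- A finite quiver together with a set of quadratic (length two) monomial
relations: `rel a b` means that the length-two path `ab` belongs to the
relation ideal `I`. -/
structure QuivRel where
  /-- vertices -/
  V : Type
  /-- arrows -/
  A : Type
  [instVFin : Fintype V]
  [instVDec : DecidableEq V]
  [instAFin : Fintype A]
  [instADec : DecidableEq A]
  /-- start vertex of an arrow -/
  src : A → V
  /-- end vertex of an arrow -/
  tgt : A → V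
  /-- the set of length-two zero relations -/
  rel : A → A → Prop
  rel_comp : ∀ a b, rel a b → tgt a = src b

attribute [instance] QuivRel.instVFin QuivRel.instVDec QuivRel.instAFin QuivRel.instADec

namespace QuivRel

variable (G : QuivRel)

/-- Condition (i) and (ii): `(Q,I)` is special biserial (the relation ideal `I`
being generated by the paths of length two recorded in `rel`). -/
def SpecialBiserial : Prop :=
  (∀ v : G.V, Nat.card {a : G.A // G.src a = v} ≤ 2) ∧
  (∀ v : G.V, Nat.card {a : G.A // G.tgt a = v} ≤ 2) ∧
  (∀ a b c : G.A, G.tgt a = G.src b → ¬ G.rel a b → G.tgt a = G.src c → ¬ G.rel a c → b = c) ∧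
  (∀ a b c : G.A, G.tgt b = G.src a → ¬ G.rel b a → G.tgt c = G.src a → ¬ G.rel c a → b = c)

/-- `(Q,I)` is a gentle quiver: special biserial, `I` generated by paths of
length two (built into the data), and conditions (iv). -/
def Gentle : Prop :=
  G.SpecialBiserial ∧
  (∀ a b c : G.A, G.rel a b → G.rel a c → b = c) ∧
  (∀ a b c : G.A, G.rel b a → G.rel c a → b = c)

/-- A (composable) path all of whose length-two subpaths avoid the relations;
these are exactly the paths which are nonzero in the monomial algebra `KQ/I`. -/
def IsNonzeroPath (p : List G.A) : Prop :=
  p.Chain' (fun a b => G.tgt a = G.src b ∧ ¬ G.rel a b)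

/-- Nonzero paths from `i` to `j`; the empty list is the trivial path `e_i`
(so we require `i = j` for it). -/
def IsNonzeroPathFrom (i j : G.V) (p : List G.A) : Prop :=
  G.IsNonzeroPath p ∧ (∀ a ∈ p.head?, G.src a = i) ∧
    (∀ a ∈ p.getLast?, G.tgt a = j) ∧ (p = [] → i = j)

/-- Finite-dimensionality of `KQ/I`: nonzero paths have bounded length. -/
def FinDim : Prop := ∃ N, ∀ p : List G.A, G.IsNonzeroPath p → p.length ≤ N

/-- The `q`-Cartan matrix of `A = KQ/I`: the `(i,j)`-entry is the Poincaré
polynomial `∑_n dim_K (e_i A e_j)_n qⁿ`, i.e. each nonzero path from `i` to `j`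
contributes `q^(its length)`. -/
noncomputable def qCartan : Matrix G.V G.V (Polynomial ℤ) := fun i j =>
  ∑ᶠ n : ℕ,
    (Nat.card {p : List G.A // p.length = n ∧ G.IsNonzeroPathFrom i j p} : Polynomial ℤ) *
      Polynomial.X ^ n

/-- The ordinary Cartan matrix of `A = KQ/I`: the `(i,j)`-entry is
`dim_K e_i A e_j`, the number of nonzero paths from `i` to `j`. -/
noncomputable def cartan : Matrix G.V G.V ℤ := fun i j =>
  (Nat.card {p : List G.A // G.IsNonzeroPathFrom i j p} : ℤ)

/-- An oriented cycle with full zero relations, recorded as the (nonempty) list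
of its arrows: any two cyclically consecutive arrows form a relation (this in
particular forces consecutive arrows to be composable, and the start and end
points to agree). -/
def IsZeroCycle (p : List G.A) : Prop :=
  p ≠ [] ∧ ∀ i : Fin p.length,
    G.rel (p.get i) (p.get ⟨(i.1 + 1) % p.length,
      Nat.mod_lt _ (Nat.lt_of_le_of_lt (Nat.zero_le _) i.2)⟩)

/-- A minimal oriented cycle with full zero relations: its arrows are pairwise
distinct. -/
def IsMinZeroCycle (p : List G.A) : Prop := G.IsZeroCycle p ∧ p.Nodup

/-- Lists satisfying a property, up to cyclic rotation. Oriented cycles are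
sequences of arrows up to cyclic rotation. -/
def cycleSetoid (P : List G.A → Prop) : Setoid {p : List G.A // P p} :=
  Setoid.comap Subtype.val (List.IsRotated.setoid G.A)

/-- `c_k`, the number of minimal oriented `k`-cycles in `Q` with full zero
relations (cycles being counted up to cyclic rotation). -/
noncomputable def numCycles (k : ℕ) : ℕ :=
  Nat.card (Quotient (G.cycleSetoid (fun p => G.IsMinZeroCycle p ∧ p.length = k)))

/-- The total number of minimal oriented cycles in `Q` with full zero relations. -/
noncomputable def totalCycles : ℕ :=
  Nat.card (Quotient (G.cycleSetoid (fun p => G.IsMinZeroCycle p)))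

/-- `ec(Q,I)`, the number of minimal oriented cycles with full zero relations
of even length. -/
noncomputable def ec : ℕ :=
  Nat.card (Quotient (G.cycleSetoid (fun p => G.IsMinZeroCycle p ∧ Even p.length)))

/-- `oc(Q,I)`, the number of minimal oriented cycles with full zero relations
of odd length. -/
noncomputable def oc : ℕ :=
  Nat.card (Quotient (G.cycleSetoid (fun p => G.IsMinZeroCycle p ∧ Odd p.length)))

end QuivRel

/-- Two square matrices over a commutative ring are unimodularly equivalent if
they differ by multiplication by matrices of determinant `1` on either side. -/
def UnimodEquiv {n : Type} [Fintype n] [DecidableEq n] {R : Type} [CommRing R]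
    (C D : Matrix n n R) : Prop :=
  ∃ P Q : Matrix n n R, P.det = 1 ∧ Q.det = 1 ∧ D = P * C * Q

namespace QuivRel

variable (G : QuivRel) (Sp : Finset G.V)

/-- The quiver with relations `(Q^sp, I^sp)` obtained from `(Q,I)` by adding a
loop with square zero at each vertex of `Sp`.  The set `Sp` is an admissible
set of special vertices when `(Q^sp, I^sp)` is again gentle (in particular
finite-dimensional). -/
def addLoops : QuivRel where
  V := G.V
  A := G.A ⊕ {v : G.V // v ∈ Sp}
  src := Sum.elim G.src (fun v => v.1)
  tgt := Sum.elim G.tgt (fun v => v.1)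
  rel a b :=
    match a, b with
    | Sum.inl a, Sum.inl b => G.rel a b
    | Sum.inr v, Sum.inr w => v = w
    | _, _ => False
  rel_comp a b h := by
    cases a <;> cases b
    · exact G.rel_comp _ _ h
    · exact h.elim
    · exact h.elim
    · exact congrArg Subtype.val h

/-- Vertices of the covering skewed-gentle quiver `Q̂`: an ordinary vertex `v`
stays as it is (encoded `(v, false)`), while a special vertex `v ∈ Sp` is
doubled into `v⁻ = (v, false)` and `v⁺ = (v, true)`. -/
abbrev hatV : Type := {x : G.V × Bool // x.1 ∉ Sp → x.2 = false}

/-- Arrows of `Q̂`: an arrow `a` of `Q` together with a sign for each special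
endpoint (the sign being `false` at ordinary endpoints), giving the doubling
(resp. quadrupling) of arrows at special endpoints. -/
abbrev hatA : Type :=
  {x : G.A × Bool × Bool //
    (G.src x.1 ∉ Sp → x.2.1 = false) ∧ (G.tgt x.1 ∉ Sp → x.2.2 = false)}

/-- The covering skewed-gentle quiver `(Q̂, Î)`, together with the *monomial*
part of its relations: each zero relation `ab ∈ I` whose middle vertex is
ordinary gives zero relations on all length-two paths lying over `ab`.
(The mesh commutation relations at special vertices are recorded separately in
`MeshSwap` below.) -/
def hatQuiv : QuivRel where
  V := hatV G Sp
  A := hatA G Sp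
  src x := ⟨(G.src x.1.1, x.1.2.1), x.2.1⟩
  tgt x := ⟨(G.tgt x.1.1, x.1.2.2), x.2.2⟩
  rel x y := G.rel x.1.1 y.1.1 ∧ x.1.2.2 = y.1.2.1 ∧ G.tgt x.1.1 ∉ Sp
  rel_comp := by
    rintro x y ⟨h1, h2, h3⟩
    exact Subtype.ext (Prod.ext (G.rel_comp _ _ h1) h2)

/-- One application of a mesh commutation relation: in a path in `Q̂`, two
consecutive arrows lying over a zero relation `ab ∈ I` whose middle vertex is
special may be replaced by the two arrows over `a`, `b` with the same outer
signs and the opposite (well, any matching) middle sign; the two resulting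
paths coincide in the skewed-gentle algebra `Â = KQ̂/Î`. -/
def MeshSwap : List (G.hatA Sp) → List (G.hatA Sp) → Prop := fun p q =>
  ∃ (l₁ l₂ : List (G.hatA Sp)) (u v u' v' : G.hatA Sp),
    p = l₁ ++ u :: v :: l₂ ∧ q = l₁ ++ u' :: v' :: l₂ ∧
    u.1.1 = u'.1.1 ∧ v.1.1 = v'.1.1 ∧
    u.1.2.1 = u'.1.2.1 ∧ v.1.2.2 = v'.1.2.2 ∧
    u.1.2.2 = v.1.2.1 ∧ u'.1.2.2 = v'.1.2.1 ∧
    G.rel u.1.1 v.1.1 ∧ G.tgt u.1.1 ∈ Sp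

/-- Paths in `Q̂` satisfying a property, up to the equivalence generated by the
mesh commutation relations.  A basis of `e_i Â e_j` is given by the classes of
nonzero paths from `i` to `j` in `(Q̂, Î)`. -/
def meshSetoid (P : List (G.hatA Sp) → Prop) : Setoid {p : List (G.hatA Sp) // P p} :=
  Setoid.comap Subtype.val (Relation.EqvGen.setoid (G.MeshSwap Sp))

/-- The `q`-Cartan matrix of the skewed-gentle algebra `Â = KQ̂/Î`: the
`(i,j)`-entry is `∑_n dim_K (e_i Â e_j)_n qⁿ`, where `(e_i Â e_j)_n` has as
basis the mesh-equivalence classes of nonzero paths of length `n` from `i` to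
`j` in `(Q̂, Î)`. -/
noncomputable def hatQCartan :
    Matrix (G.hatQuiv Sp).V (G.hatQuiv Sp).V (Polynomial ℤ) := fun i j =>
  ∑ᶠ n : ℕ,
    (Nat.card (Quotient (G.meshSetoid Sp
        (fun p => p.length = n ∧ (G.hatQuiv Sp).IsNonzeroPathFrom i j p))) : Polynomial ℤ) *
      Polynomial.X ^ n

/-- The ordinary Cartan matrix of the skewed-gentle algebra `Â = KQ̂/Î`. -/
noncomputable def hatCartan : Matrix (G.hatQuiv Sp).V (G.hatQuiv Sp).V ℤ := fun i j =>
  (Nat.card (Quotient (G.meshSetoid Sp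
      (fun p => (G.hatQuiv Sp).IsNonzeroPathFrom i j p))) : ℤ)

end QuivRel

/-- Arrows of a quiver with vertex weights, such that composability of arrows, counted with
weights, splits into the nonzero compositions `nz` and the zero relations `rl`. -/
structure WeightedArrows (V A : Type) [DecidableEq V] where
  /-- start vertex -/
  src : A → V
  /-- end vertex -/
  tgt : A → V
  /-- weight of a vertex -/
  wt : V → ℕ
  /-- multiplicity of the nonzero composition of two arrows -/
  nz : A → A → ℕ
  /-- multiplicity of the zero relation between two arrows -/
  rl : A → A → ℕ
  /-- a height function, increasing along nonzero compositions -/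
  ht : A → ℕ
  nz_add_rl : ∀ a b, nz a b + rl a b = if tgt a = src b then wt (tgt a) else 0
  ht_lt : ∀ a b, nz a b ≠ 0 → ht a < ht b
  rl_le_one : ∀ a b, rl a b ≤ 1
  rl_right_unique : ∀ a b c, rl a b ≠ 0 → rl a c ≠ 0 → b = c
  rl_left_unique : ∀ a b c, rl b a ≠ 0 → rl c a ≠ 0 → b = c

theorem one_sub_mul_rankOne_update {R : Type*} [Ring R] {N W e : R} (he : e * e = e)
    (hW : (1 - N) * W = 1) (hW' : e * W * e = e) :
    (1 - (1 - e) * N * (1 - e)) * (W - W * e * W + e) = 1 := by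
  have h2 : N * W = W - 1 := by rw [← hW]; noncomm_ring
  have h2' : ∀ x, N * (W * x) = W * x - x := fun x => by
    rw [← mul_assoc, h2, sub_mul, one_mul]
  have he' : ∀ x, e * (e * x) = e * x := fun x => by rw [← mul_assoc, he]
  have h3' : ∀ x, e * (W * (e * x)) = e * x := fun x => by
    rw [← mul_assoc, ← mul_assoc, hW']
  simp only [mul_sub, sub_mul, mul_add, mul_assoc, he, he', h2, h2', h3',
    one_mul, mul_one]
  abel

theorem Matrix.det_one_sub_vecMulVec {n R : Type*} [Fintype n] [DecidableEq n] [CommRing R]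
    (x y : n → R) : (1 - Matrix.vecMulVec x y).det = 1 - y ⬝ᵥ x := by
  rw [sub_eq_add_neg, ← Matrix.neg_vecMulVec, Matrix.vecMulVec_eq Unit,
    Matrix.det_one_add_replicateCol_mul_replicateRow, dotProduct_neg, sub_eq_add_neg]

namespace UnimodEquiv

variable {n : Type} [Fintype n] [DecidableEq n] {R : Type} [CommRing R]

theorem refl (C : Matrix n n R) : UnimodEquiv C C := ⟨1, 1, by simp, by simp, by simp⟩

theorem trans {C D E : Matrix n n R} (h : UnimodEquiv C D) (h' : UnimodEquiv D E) :
    UnimodEquiv C E := by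
  obtain ⟨P, Q, hP, hQ, rfl⟩ := h
  obtain ⟨P', Q', hP', hQ', rfl⟩ := h'
  exact ⟨P' * P, Q * Q', by simp [hP, hP'], by simp [hQ, hQ'], by simp only [Matrix.mul_assoc]⟩

theorem mul_left {P : Matrix n n R} (hP : P.det = 1) (C : Matrix n n R) :
    UnimodEquiv C (P * C) := ⟨P, 1, hP, by simp, by simp⟩

theorem mul_right {Q : Matrix n n R} (hQ : Q.det = 1) (C : Matrix n n R) :
    UnimodEquiv C (C * Q) := ⟨1, Q, by simp, hQ, by simp⟩

end UnimodEquiv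

theorem Matrix.diagonal_mul_one_sub_vecMulVec {n R : Type*} [Fintype n] [DecidableEq n]
    [CommRing R] {d x y : n → R} (hx : ∀ v, x v ≠ 0 → d v = 1) (hy : ∀ v, y v ≠ 0 → d v = 1) :
    Matrix.diagonal d * (1 - Matrix.vecMulVec x y) =
      (1 - Matrix.vecMulVec x y) * Matrix.diagonal d := by
  ext i j
  have h1 : d i * (x i * y j) = x i * y j := by
    by_cases h : x i = 0
    · simp [h]
    · simp [hx i h]
  have h2 : x i * y j * d j = x i * y j := by
    by_cases h : y j = 0
    · simp [h]
    · simp [hy j h]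
  simp only [Matrix.diagonal_mul, Matrix.mul_diagonal, Matrix.sub_apply, Matrix.vecMulVec_apply,
    mul_sub, sub_mul, h1, h2]
  congr 1
  by_cases h : i = j
  · subst h; simp
  · simp [Matrix.one_apply_ne h]

namespace WeightedArrows

set_option linter.unusedSectionVars false

open Polynomial Matrix

variable {V A : Type} [Fintype V] [DecidableEq V] [Fintype A] [DecidableEq A]
  (G : WeightedArrows V A) (B : Finset A)

/-- The matrix of nonzero compositions of arrows in `B`. -/
noncomputable def stepMatrix : Matrix A A ℤ[X] :=
  fun a b => if a ∈ B ∧ b ∈ B then (G.nz a b : ℤ[X]) else 0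

/-- The matrix of zero relations between arrows in `B`. -/
noncomputable def relMatrix : Matrix A A ℤ[X] :=
  fun a b => if a ∈ B ∧ b ∈ B then (G.rl a b : ℤ[X]) else 0

/-- The incidence matrix between vertices and the arrows in `B` starting there. -/
noncomputable def srcMatrix : Matrix V A ℤ[X] :=
  fun v a => if a ∈ B ∧ G.src a = v then 1 else 0

/-- The weighted incidence matrix between the arrows in `B` and their end vertices. -/
noncomputable def tgtMatrix : Matrix A V ℤ[X] :=
  fun a v => if a ∈ B ∧ G.tgt a = v then (G.wt v : ℤ[X]) else 0

/-- A strict upper bound for all heights. -/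
def bound : ℕ := ∑ a, G.ht a + 1

/-- The inverse of `1 - X • stepMatrix`, counting paths between arrows. -/
noncomputable def pathMatrix : Matrix A A ℤ[X] :=
  ∑ n ∈ Finset.range G.bound, ((X : ℤ[X]) • G.stepMatrix B) ^ n

/-- Paths ending with a given arrow, without counting that arrow. -/
noncomputable def leftMatrix : Matrix V A ℤ[X] := G.srcMatrix B * G.pathMatrix B

/-- Paths starting with a given arrow, weighted by their end vertex. -/
noncomputable def rightMatrix : Matrix A V ℤ[X] :=
  (X : ℤ[X]) • (G.pathMatrix B * G.tgtMatrix B)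

/-- The weighted `q`-Cartan matrix of the paths using only arrows in `B`. -/
noncomputable def cartanMatrix : Matrix V V ℤ[X] := 1 + G.srcMatrix B * G.rightMatrix B

theorem ht_lt_of_stepMatrix {a b : A} (h : G.stepMatrix B a b ≠ 0) : G.ht a < G.ht b := by
  unfold stepMatrix at h
  split_ifs at h
  · exact G.ht_lt _ _ (by exact_mod_cast h)
  · exact absurd rfl h

theorem ht_add_le_of_pow {N : Matrix A A ℤ[X]} (hN : ∀ a b, N a b ≠ 0 → G.ht a < G.ht b)
    (n : ℕ) : ∀ a b, (N ^ n) a b ≠ 0 → G.ht a + n ≤ G.ht b := by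
  induction n with
  | zero =>
    intro a b h
    have : a = b := by
      by_contra hab
      exact h (by simp [Matrix.one_apply_ne hab])
    simp [this]
  | succ n ih =>
    intro a b h
    rw [pow_succ, Matrix.mul_apply] at h
    obtain ⟨c, -, hc⟩ := Finset.exists_ne_zero_of_sum_ne_zero h
    have h1 := ih a c (left_ne_zero_of_mul hc)
    have h2 := hN c b (right_ne_zero_of_mul hc)
    omega

theorem ht_lt_bound (a : A) : G.ht a < G.bound :=
  Nat.lt_succ_of_le (Finset.single_le_sum (f := G.ht) (fun _ _ => Nat.zero_le _)
    (Finset.mem_univ a))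

theorem pow_bound_eq_zero {N : Matrix A A ℤ[X]} (hN : ∀ a b, N a b ≠ 0 → G.ht a < G.ht b) :
    N ^ G.bound = 0 := by
  refine Matrix.ext fun a b => ?_
  by_contra h
  have h1 := G.ht_add_le_of_pow hN _ a b h
  have h2 := G.ht_lt_bound b
  omega

theorem ht_lt_of_smul_stepMatrix (a b : A) (h : ((X : ℤ[X]) • G.stepMatrix B) a b ≠ 0) :
    G.ht a < G.ht b :=
  G.ht_lt_of_stepMatrix B (right_ne_zero_of_mul (a := (X : ℤ[X]))
    (by simpa only [Matrix.smul_apply, smul_eq_mul] using h))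

theorem ht_le_of_pathMatrix {a b : A} (h : G.pathMatrix B a b ≠ 0) : G.ht a ≤ G.ht b := by
  rw [pathMatrix, Matrix.sum_apply] at h
  obtain ⟨n, -, hn⟩ := Finset.exists_ne_zero_of_sum_ne_zero h
  have := G.ht_add_le_of_pow (G.ht_lt_of_smul_stepMatrix B) n a b hn
  omega

theorem one_sub_mul_pathMatrix : (1 - (X : ℤ[X]) • G.stepMatrix B) * G.pathMatrix B = 1 := by
  rw [pathMatrix, mul_neg_geom_sum, G.pow_bound_eq_zero (G.ht_lt_of_smul_stepMatrix B), sub_zero]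

theorem pathMatrix_mul_one_sub : G.pathMatrix B * (1 - (X : ℤ[X]) • G.stepMatrix B) = 1 := by
  rw [pathMatrix, geom_sum_mul_neg, G.pow_bound_eq_zero (G.ht_lt_of_smul_stepMatrix B), sub_zero]

theorem pathMatrix_eq : G.pathMatrix B = 1 + (X : ℤ[X]) • (G.stepMatrix B * G.pathMatrix B) := by
  have h := G.one_sub_mul_pathMatrix B
  rw [Matrix.sub_mul, Matrix.one_mul, Matrix.smul_mul] at h
  rw [← h]; abel

theorem pathMatrix_eq' : G.pathMatrix B = 1 + (X : ℤ[X]) • (G.pathMatrix B * G.stepMatrix B) := by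
  have h := G.pathMatrix_mul_one_sub B
  rw [Matrix.mul_sub, Matrix.mul_one, Matrix.mul_smul] at h
  rw [← h]; abel

theorem pathMatrix_self (a : A) : G.pathMatrix B a a = 1 := by
  rw [pathMatrix_eq, Matrix.add_apply, Matrix.one_apply_eq, Matrix.smul_apply, Matrix.mul_apply,
    Finset.sum_eq_zero, smul_zero, add_zero]
  intro b _
  by_contra h
  have h1 := G.ht_lt_of_stepMatrix B (left_ne_zero_of_mul h)
  have h2 := G.ht_le_of_pathMatrix B (right_ne_zero_of_mul h)
  omega

theorem tgtMatrix_mul_srcMatrix :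
    G.tgtMatrix B * G.srcMatrix B = G.stepMatrix B + G.relMatrix B := by
  ext a b : 2
  have h := congrArg (Nat.cast : ℕ → ℤ[X]) (G.nz_add_rl a b)
  push_cast at h
  simp only [Matrix.mul_apply, tgtMatrix, srcMatrix, Matrix.add_apply, stepMatrix, relMatrix]
  by_cases ha : a ∈ B <;> by_cases hb : b ∈ B <;> simp [ha, hb, h]
  by_cases hc : G.tgt a = G.src b
  · simp [hc]
  · simp [hc]

theorem leftMatrix_eq :
    G.leftMatrix B = G.srcMatrix B + (X : ℤ[X]) • (G.leftMatrix B * G.stepMatrix B) := by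
  conv_lhs => rw [leftMatrix, pathMatrix_eq', Matrix.mul_add, Matrix.mul_one, Matrix.mul_smul,
    ← Matrix.mul_assoc]
  rfl

theorem rightMatrix_eq :
    G.rightMatrix B =
      (X : ℤ[X]) • G.tgtMatrix B + (X : ℤ[X]) • (G.stepMatrix B * G.rightMatrix B) := by
  conv_lhs => rw [rightMatrix, pathMatrix_eq, Matrix.add_mul, Matrix.one_mul, Matrix.smul_mul,
    Matrix.mul_assoc, smul_add, ← Matrix.mul_smul]
  rfl

theorem cartanMatrix_eq :
    G.cartanMatrix B = 1 + (X : ℤ[X]) • (G.leftMatrix B * G.tgtMatrix B) := by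
  rw [cartanMatrix, rightMatrix, leftMatrix, Matrix.mul_smul, Matrix.mul_assoc]

theorem cartanMatrix_mul_srcMatrix : G.cartanMatrix B * G.srcMatrix B =
    G.leftMatrix B + (X : ℤ[X]) • (G.leftMatrix B * G.relMatrix B) := by
  rw [cartanMatrix_eq, Matrix.add_mul, Matrix.one_mul, Matrix.smul_mul, Matrix.mul_assoc,
    tgtMatrix_mul_srcMatrix, Matrix.mul_add, smul_add, ← add_assoc, ← leftMatrix_eq]

theorem tgtMatrix_mul_cartanMatrix : (X : ℤ[X]) • (G.tgtMatrix B * G.cartanMatrix B) =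
    G.rightMatrix B + (X : ℤ[X]) • (G.relMatrix B * G.rightMatrix B) := by
  rw [cartanMatrix, Matrix.mul_add, Matrix.mul_one, ← Matrix.mul_assoc,
    tgtMatrix_mul_srcMatrix, Matrix.add_mul, smul_add, smul_add, ← add_assoc, ← rightMatrix_eq]

variable {B}

theorem leftMatrix_apply_add {a : A} (ha : a ∈ B) (v : V) :
    G.leftMatrix B v a + X * (G.leftMatrix B * G.relMatrix B) v a =
      G.cartanMatrix B v (G.src a) := by
  have h := congrFun (congrFun (G.cartanMatrix_mul_srcMatrix B) v) a
  rw [Matrix.add_apply, Matrix.smul_apply, smul_eq_mul] at h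
  rw [← h, Matrix.mul_apply]
  simp [srcMatrix, ha]

theorem rightMatrix_apply_add {a : A} (ha : a ∈ B) (w : V) :
    G.rightMatrix B a w + X * (G.relMatrix B * G.rightMatrix B) a w =
      (X : ℤ[X]) * (G.wt (G.tgt a) : ℤ[X]) * G.cartanMatrix B (G.tgt a) w := by
  have h := congrFun (congrFun (G.tgtMatrix_mul_cartanMatrix B) a) w
  rw [Matrix.add_apply, Matrix.smul_apply, Matrix.smul_apply, smul_eq_mul, smul_eq_mul] at h
  rw [← h, Matrix.mul_apply, mul_assoc]
  simp [tgtMatrix, ha]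

theorem one_sub_single_eq_diagonal (a : A) : (1 - single a a (1 : ℤ[X]) : Matrix A A ℤ[X]) =
    diagonal fun b => if b = a then 0 else 1 := by
  refine Matrix.ext fun i j => ?_
  rw [Matrix.sub_apply, Matrix.one_apply, Matrix.single_apply, Matrix.diagonal_apply]
  grind

theorem stepMatrix_erase (a : A) : G.stepMatrix (B.erase a) =
    (1 - single a a (1 : ℤ[X])) * G.stepMatrix B * (1 - single a a (1 : ℤ[X])) := by
  refine Matrix.ext fun i j => ?_
  rw [one_sub_single_eq_diagonal, Matrix.mul_diagonal, Matrix.diagonal_mul]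
  unfold stepMatrix
  by_cases hi : i = a <;> by_cases hj : j = a <;> simp [hi, hj]

theorem srcMatrix_erase (a : A) :
    G.srcMatrix (B.erase a) = G.srcMatrix B * (1 - single a a (1 : ℤ[X])) := by
  refine Matrix.ext fun i j => ?_
  rw [one_sub_single_eq_diagonal, Matrix.mul_diagonal]
  unfold srcMatrix
  by_cases hj : j = a <;> simp [hj]

theorem tgtMatrix_erase (a : A) :
    G.tgtMatrix (B.erase a) = (1 - single a a (1 : ℤ[X])) * G.tgtMatrix B := by
  refine Matrix.ext fun i j => ?_
  rw [one_sub_single_eq_diagonal, Matrix.diagonal_mul]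
  unfold tgtMatrix
  by_cases hi : i = a <;> simp [hi]

theorem pathMatrix_erase (a : A) : G.pathMatrix (B.erase a) =
    G.pathMatrix B - G.pathMatrix B * single a a (1 : ℤ[X]) * G.pathMatrix B +
      single a a (1 : ℤ[X]) := by
  have h := one_sub_mul_rankOne_update (N := (X : ℤ[X]) • G.stepMatrix B) (W := G.pathMatrix B)
    (e := single a a (1 : ℤ[X])) (by simp) (G.one_sub_mul_pathMatrix B)
    (by rw [Matrix.single_mul_mul_single]; simp [G.pathMatrix_self B])
  rw [Matrix.mul_smul, Matrix.smul_mul, ← stepMatrix_erase] at h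
  have h' := G.pathMatrix_mul_one_sub (B.erase a)
  calc G.pathMatrix (B.erase a) = G.pathMatrix (B.erase a) * 1 := by rw [Matrix.mul_one]
    _ = _ := by rw [← h, ← Matrix.mul_assoc, h', Matrix.one_mul]

theorem cartanMatrix_erase (a : A) : G.cartanMatrix (B.erase a) =
    G.cartanMatrix B - vecMulVec (fun v => G.leftMatrix B v a) (G.rightMatrix B a) := by
  have he : (single a a (1 : ℤ[X]) : Matrix A A ℤ[X]) * single a a (1 : ℤ[X]) =
      single a a (1 : ℤ[X]) := by simp
  have hW : (single a a (1 : ℤ[X]) : Matrix A A ℤ[X]) * G.pathMatrix B *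
      single a a (1 : ℤ[X]) = single a a (1 : ℤ[X]) := by
    rw [Matrix.single_mul_mul_single]; simp [G.pathMatrix_self B]
  have h1 : (1 - single a a (1 : ℤ[X])) *
      (G.pathMatrix B - G.pathMatrix B * single a a (1 : ℤ[X]) * G.pathMatrix B +
      single a a (1 : ℤ[X])) * (1 - single a a (1 : ℤ[X])) =
      G.pathMatrix B - G.pathMatrix B * single a a (1 : ℤ[X]) * G.pathMatrix B := by
    generalize (single a a (1 : ℤ[X]) : Matrix A A ℤ[X]) = e at *
    generalize G.pathMatrix B = W at *
    have h3 : e * (W * e) = e := by rw [← mul_assoc, hW]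
    have h3' : ∀ x, e * (W * (e * x)) = e * x := fun x => by
      rw [← mul_assoc, ← mul_assoc, hW]
    simp only [mul_sub, sub_mul, mul_add, add_mul, mul_assoc, he, h3, h3', one_mul, mul_one]
    abel
  have h2 : vecMulVec (fun v => G.leftMatrix B v a) (G.rightMatrix B a) =
      G.leftMatrix B * single a a (1 : ℤ[X]) * G.rightMatrix B := by
    refine Matrix.ext fun i j => ?_
    rw [vecMulVec_apply, Matrix.mul_assoc, Matrix.mul_apply, Finset.sum_eq_single a]
    · simp
    · intro b _ hb
      simp [hb]
    · simp
  rw [h2, cartanMatrix, cartanMatrix, rightMatrix, rightMatrix, leftMatrix, pathMatrix_erase,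
    srcMatrix_erase, tgtMatrix_erase]
  have h4 := congrArg (fun Z => G.srcMatrix B * Z * G.tgtMatrix B) h1
  simp only [Matrix.mul_sub (G.srcMatrix B), Matrix.sub_mul, Matrix.mul_assoc] at h4
  simp only [Matrix.mul_smul, Matrix.mul_assoc, add_sub_assoc, ← smul_sub, Matrix.sub_mul]
  simp only [Matrix.mul_sub (G.srcMatrix B)]
  rw [h4]

theorem exists_src_of_leftMatrix {v : V} {a : A} (h : G.leftMatrix B v a ≠ 0) :
    ∃ x ∈ B, G.src x = v ∧ G.ht x ≤ G.ht a := by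
  rw [leftMatrix, Matrix.mul_apply] at h
  obtain ⟨x, -, hx⟩ := Finset.exists_ne_zero_of_sum_ne_zero h
  have h1 := left_ne_zero_of_mul hx
  unfold srcMatrix at h1
  split_ifs at h1 with h2
  · exact ⟨x, h2.1, h2.2, G.ht_le_of_pathMatrix B (right_ne_zero_of_mul hx)⟩
  · exact absurd rfl h1

theorem exists_tgt_of_rightMatrix {w : V} {a : A} (h : G.rightMatrix B a w ≠ 0) :
    ∃ x ∈ B, G.tgt x = w ∧ G.wt w ≠ 0 ∧ G.ht a ≤ G.ht x := by
  rw [rightMatrix, Matrix.smul_apply, smul_eq_mul] at h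
  replace h := right_ne_zero_of_mul h
  rw [Matrix.mul_apply] at h
  obtain ⟨x, -, hx⟩ := Finset.exists_ne_zero_of_sum_ne_zero h
  have h1 := right_ne_zero_of_mul hx
  unfold tgtMatrix at h1
  split_ifs at h1 with h2
  · exact ⟨x, h2.1, h2.2, by exact_mod_cast h1, G.ht_le_of_pathMatrix B (left_ne_zero_of_mul hx)⟩
  · exact absurd rfl h1

/-- A scaling of the vertices which is trivial at the end points of the arrows in `B`. -/
def IsTrivialOn (B : Finset A) (D : V → ℤ[X]) : Prop :=
  ∀ a ∈ B, D (G.src a) = 1 ∧ D (G.tgt a) = 1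

variable {G}

theorem IsTrivialOn.mono {B' : Finset A} {D : V → ℤ[X]} (h : G.IsTrivialOn B D) (hB : B' ⊆ B) :
    G.IsTrivialOn B' D := fun a ha => h a (hB ha)

theorem unimodEquiv_erase_of_no_successor {a : A} (ha : a ∈ B) (h : ∀ b ∈ B, G.rl a b = 0)
    {D : V → ℤ[X]} (hD : G.IsTrivialOn B D) :
    UnimodEquiv (diagonal D * G.cartanMatrix B) (diagonal D * G.cartanMatrix (B.erase a)) := by
  have h1 : ∀ w, G.rightMatrix B a w =
      (X : ℤ[X]) * (G.wt (G.tgt a) : ℤ[X]) * G.cartanMatrix B (G.tgt a) w := by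
    intro w
    rw [← G.rightMatrix_apply_add ha, Matrix.mul_apply, Finset.sum_eq_zero, mul_zero, add_zero]
    intro b _
    by_cases hb : b ∈ B <;> simp [relMatrix, hb, h]
  have h2 : G.cartanMatrix (B.erase a) =
      (1 - vecMulVec (fun v => (X : ℤ[X]) * (G.wt (G.tgt a) : ℤ[X]) * G.leftMatrix B v a)
        (Pi.single (G.tgt a) 1)) * G.cartanMatrix B := by
    rw [cartanMatrix_erase, Matrix.sub_mul, Matrix.one_mul, vecMulVec_mul]
    congr 1
    refine Matrix.ext fun v w => ?_
    rw [vecMulVec_apply, vecMulVec_apply, h1, Matrix.single_one_vecMul]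
    simp only [Matrix.row]
    ring
  rw [h2, ← Matrix.mul_assoc, diagonal_mul_one_sub_vecMulVec, Matrix.mul_assoc]
  · apply UnimodEquiv.mul_left
    rw [det_one_sub_vecMulVec, single_one_dotProduct]
    by_contra hne
    have h3 : X * (G.wt (G.tgt a) : ℤ[X]) * G.leftMatrix B (G.tgt a) a ≠ 0 := fun h0 =>
      hne (by rw [h0, sub_zero])
    obtain ⟨x, hxB, hx, hht⟩ := G.exists_src_of_leftMatrix (right_ne_zero_of_mul h3)
    have h4 : G.wt (G.tgt a) ≠ 0 := by
      exact_mod_cast right_ne_zero_of_mul (left_ne_zero_of_mul h3)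
    have h5 := G.nz_add_rl a x
    rw [h x hxB, if_pos hx.symm, add_zero] at h5
    have := G.ht_lt a x (h5 ▸ h4)
    omega
  · intro v hv
    obtain ⟨x, hxB, hx, -⟩ := G.exists_src_of_leftMatrix (right_ne_zero_of_mul hv)
    exact hx ▸ (hD x hxB).1
  · intro v hv
    by_cases h : v = G.tgt a
    · exact h ▸ (hD a ha).2
    · simp [h] at hv

theorem unimodEquiv_erase_of_no_predecessor {a : A} (ha : a ∈ B) (h : ∀ b ∈ B, G.rl b a = 0)
    (D : V → ℤ[X]) :
    UnimodEquiv (diagonal D * G.cartanMatrix B) (diagonal D * G.cartanMatrix (B.erase a)) := by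
  have h1 : ∀ v, G.leftMatrix B v a = G.cartanMatrix B v (G.src a) := by
    intro v
    rw [← G.leftMatrix_apply_add ha, Matrix.mul_apply, Finset.sum_eq_zero, mul_zero, add_zero]
    intro b _
    by_cases hb : b ∈ B <;> simp [relMatrix, hb, h]
  have h2 : G.cartanMatrix (B.erase a) =
      G.cartanMatrix B * (1 - vecMulVec (Pi.single (G.src a) 1) (G.rightMatrix B a)) := by
    rw [cartanMatrix_erase, Matrix.mul_sub, Matrix.mul_one, mul_vecMulVec]
    congr 1
    refine Matrix.ext fun v w => ?_
    rw [vecMulVec_apply, vecMulVec_apply, h1, Matrix.mulVec_single_one]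
    rfl
  rw [h2, ← Matrix.mul_assoc]
  apply UnimodEquiv.mul_right
  rw [det_one_sub_vecMulVec, dotProduct_single_one]
  by_contra hne
  obtain ⟨x, hxB, hx, hwt, hht⟩ := G.exists_tgt_of_rightMatrix (w := G.src a) (a := a)
    (B := B) (fun h0 => hne (by rw [h0, sub_zero]))
  have h5 := G.nz_add_rl x a
  rw [h x hxB, if_pos hx, add_zero, hx] at h5
  have := G.ht_lt x a (h5 ▸ hwt)
  omega

variable (G) in
/-- A periodic sequence of arrows, running once through an oriented cycle with full zero
relations in `k` steps. -/
structure IsCycleSeq (g : ℕ → A) (k : ℕ) : Prop where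
  pos : 0 < k
  rl_ne_zero : ∀ i, G.rl (g i) (g (i + 1)) ≠ 0
  period : g k = g 0
  inj : ∀ i < k, ∀ j < k, g i = g j → i = j

variable (G) in
/-- The set of arrows of a minimal oriented cycle with full zero relations. -/
def IsCycle (c : Finset A) : Prop :=
  ∃ g k, G.IsCycleSeq g k ∧ c = (Finset.range k).image g

namespace IsCycleSeq

variable {g : ℕ → A} {k : ℕ}

theorem add_period (h : G.IsCycleSeq g k) (i : ℕ) : g (i + k) = g i := by
  induction i with
  | zero => rw [zero_add, h.period]
  | succ i ih =>
    have h1 := h.rl_ne_zero (i + k)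
    rw [ih, show i + k + 1 = i + 1 + k by ring] at h1
    exact G.rl_right_unique _ _ _ h1 (h.rl_ne_zero i)

theorem add_mul_period (h : G.IsCycleSeq g k) (i n : ℕ) : g (i + n * k) = g i := by
  induction n with
  | zero => simp
  | succ n ih => rw [Nat.succ_mul, ← add_assoc, h.add_period, ih]

theorem mem_image (h : G.IsCycleSeq g k) (i : ℕ) : g i ∈ (Finset.range k).image g := by
  refine Finset.mem_image.2 ⟨i % k, Finset.mem_range.2 (Nat.mod_lt _ h.pos), ?_⟩
  conv_rhs => rw [← Nat.mod_add_div i k, mul_comm]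
  rw [h.add_mul_period]

theorem card_image (h : G.IsCycleSeq g k) : ((Finset.range k).image g).card = k := by
  rw [Finset.card_image_of_injOn, Finset.card_range]
  intro i hi j hj
  exact h.inj i (by simpa using hi) j (by simpa using hj)

theorem apply_add_eq {g' : ℕ → A} {k' i j : ℕ} (h : G.IsCycleSeq g k) (h' : G.IsCycleSeq g' k')
    (hij : g i = g' j) (n : ℕ) : g (i + n) = g' (j + n) := by
  induction n with
  | zero => exact hij
  | succ n ih =>
    have h2 := h.rl_ne_zero (i + n)
    rw [ih] at h2
    exact G.rl_right_unique _ _ _ h2 (h'.rl_ne_zero (j + n))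

theorem image_subset {g' : ℕ → A} {k' i j : ℕ} (h : G.IsCycleSeq g k) (h' : G.IsCycleSeq g' k')
    (hij : g i = g' j) : (Finset.range k).image g ⊆ (Finset.range k').image g' := by
  intro y hy
  obtain ⟨m, -, rfl⟩ := Finset.mem_image.1 hy
  have h3 : i ≤ m + i * k := le_add_of_le_right (Nat.le_mul_of_pos_right i h.pos)
  obtain ⟨n, hn⟩ := Nat.exists_eq_add_of_le h3
  rw [← h.add_mul_period m i, hn, h.apply_add_eq h' hij]
  exact h'.mem_image _

theorem tgt_eq_src (h : G.IsCycleSeq g k) (i : ℕ) : G.tgt (g i) = G.src (g (i + 1)) := by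
  by_contra hne
  have := G.nz_add_rl (g i) (g (i + 1))
  rw [if_neg hne] at this
  exact h.rl_ne_zero i (by omega)

theorem rightMatrix_apply (h : G.IsCycleSeq g k) (hB : ∀ i, g i ∈ B) (i : ℕ) (w : V) :
    G.rightMatrix B (g i) w = (X : ℤ[X]) * (G.wt (G.tgt (g i)) : ℤ[X]) *
      G.cartanMatrix B (G.tgt (g i)) w + (-X) * G.rightMatrix B (g (i + 1)) w := by
  rw [← G.rightMatrix_apply_add (hB i), Matrix.mul_apply, Finset.sum_eq_single (g (i + 1))]
  · have h1 : G.rl (g i) (g (i + 1)) = 1 := by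
      have := G.rl_le_one (g i) (g (i + 1))
      have := h.rl_ne_zero i
      omega
    simp [relMatrix, hB, h1]
  · intro b _ hb
    have : G.rl (g i) b = 0 := by
      by_contra hne
      exact hb (G.rl_right_unique _ _ _ hne (h.rl_ne_zero i))
    simp [relMatrix, this]
  · simp

theorem rightMatrix_apply_zero (h : G.IsCycleSeq g k) (hB : ∀ i, g i ∈ B) (n : ℕ) (w : V) :
    G.rightMatrix B (g 0) w = ∑ i ∈ Finset.range n, (-(-X : ℤ[X]) ^ (i + 1) *
      (G.wt (G.tgt (g i)) : ℤ[X])) * G.cartanMatrix B (G.tgt (g i)) w +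
      (-X) ^ n * G.rightMatrix B (g n) w := by
  induction n with
  | zero => simp
  | succ n ih =>
    rw [ih, Finset.sum_range_succ, h.rightMatrix_apply hB n]
    ring

end IsCycleSeq

theorem IsCycle.eq_of_mem {c c' : Finset A} (h : G.IsCycle c) (h' : G.IsCycle c') {x : A}
    (hx : x ∈ c) (hx' : x ∈ c') : c = c' := by
  obtain ⟨g, k, hg, rfl⟩ := h
  obtain ⟨g', k', hg', rfl⟩ := h'
  obtain ⟨i, -, rfl⟩ := Finset.mem_image.1 hx
  obtain ⟨j, -, hj⟩ := Finset.mem_image.1 hx'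
  exact (hg.image_subset hg' hj.symm).antisymm (hg'.image_subset hg hj)

theorem IsCycle.exists_successor {c : Finset A} (h : G.IsCycle c) {x : A} (hx : x ∈ c) :
    ∃ y ∈ c, G.rl x y ≠ 0 := by
  obtain ⟨g, k, hg, rfl⟩ := h
  obtain ⟨i, -, rfl⟩ := Finset.mem_image.1 hx
  exact ⟨_, hg.mem_image (i + 1), hg.rl_ne_zero i⟩

theorem IsCycle.exists_predecessor {c : Finset A} (h : G.IsCycle c) {x : A} (hx : x ∈ c) :
    ∃ y ∈ c, G.rl y x ≠ 0 := by
  obtain ⟨g, k, hg, rfl⟩ := h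
  obtain ⟨i, -, rfl⟩ := Finset.mem_image.1 hx
  have h1 := hg.rl_ne_zero (i + (k - 1))
  rw [add_assoc, Nat.sub_add_cancel hg.pos, hg.add_period] at h1
  exact ⟨_, hg.mem_image (i + (k - 1)), h1⟩

theorem exists_isCycleSeq (hsucc : ∀ a ∈ B, ∃ b ∈ B, G.rl a b ≠ 0) {p : A} (hp : p ∈ B) :
    ∃ g k, G.IsCycleSeq g k ∧ g 0 = p ∧ ∀ i, g i ∈ B := by
  choose! σ hσB hσ using hsucc
  have hB : ∀ i, σ^[i] p ∈ B := by
    intro i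
    induction i with
    | zero => exact hp
    | succ i ih => rw [Function.iterate_succ_apply']; exact hσB _ ih
  have hrl : ∀ i, G.rl (σ^[i] p) (σ^[i + 1] p) ≠ 0 := fun i => by
    rw [Function.iterate_succ_apply']; exact hσ _ (hB i)
  have hback : ∀ n i, σ^[i + n] p = σ^[i] p → σ^[n] p = p := by
    intro n i
    induction i with
    | zero => intro h; simpa using h
    | succ i ih =>
      intro h
      apply ih
      have h1 := hrl (i + n)
      rw [show i + n + 1 = i + 1 + n by ring, h] at h1
      exact G.rl_left_unique _ _ _ h1 (hrl i)
  have hex : ∃ n, 0 < n ∧ σ^[n] p = p := by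
    obtain ⟨i, j, hij, h⟩ := Finite.exists_ne_map_eq_of_infinite fun n => σ^[n] p
    rcases lt_or_gt_of_ne hij with hlt | hlt
    · exact ⟨j - i, by omega, hback _ i (by rw [Nat.add_sub_cancel' hlt.le]; exact h.symm)⟩
    · exact ⟨i - j, by omega, hback _ j (by rw [Nat.add_sub_cancel' hlt.le]; exact h)⟩
  classical
  have hinj : ∀ i j, i < j → j < Nat.find hex → σ^[i] p ≠ σ^[j] p := by
    intro i j hij hj h
    refine Nat.find_min hex (m := j - i) (by omega) ⟨by omega, hback _ i ?_⟩
    rw [Nat.add_sub_cancel' hij.le]; exact h.symm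
  refine ⟨fun i => σ^[i] p, Nat.find hex, ⟨(Nat.find_spec hex).1, hrl, (Nat.find_spec hex).2, ?_⟩,
    rfl, hB⟩
  intro i hi j hj h
  by_contra hne
  rcases lt_or_gt_of_ne hne with hlt | hlt
  · exact hinj i j hlt hj h
  · exact hinj j i hlt hi h.symm

section Cycle

variable {g : ℕ → A} {k : ℕ}

theorem IsCycleSeq.unimodEquiv_erase_head (h : G.IsCycleSeq g k) (hB : ∀ i, g i ∈ B)
    (hmin : ∀ b ∈ B, G.ht (g 0) ≤ G.ht b) {D : V → ℤ[X]} (hD : G.IsTrivialOn B D) :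
    UnimodEquiv (diagonal D * G.cartanMatrix B)
      (diagonal (fun v => D v * if v = G.src (g 0) then 1 - (-X) ^ k else 1) *
        G.cartanMatrix (B.erase (g 0))) := by
  obtain ⟨m, rfl⟩ := Nat.exists_eq_add_of_lt h.pos
  rw [zero_add] at *
  have hnz : ∀ b ∈ B, G.nz b (g 0) = 0 := by
    intro b hb
    by_contra hne
    exact absurd (G.ht_lt _ _ hne) (by have := hmin b hb; omega)
  have htgt : G.tgt (g m) = G.src (g 0) := by rw [h.tgt_eq_src, h.period]
  have hwt : G.wt (G.src (g 0)) = 1 := by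
    have h1 := G.nz_add_rl (g m) (g 0)
    have h2 := h.rl_ne_zero m
    have h3 := G.rl_le_one (g m) (g 0)
    rw [h.period] at h2
    rw [if_pos htgt, hnz _ (hB m), htgt] at h1
    omega
  have hne : ∀ i < m, G.tgt (g i) ≠ G.src (g 0) := by
    intro i hi heq
    have h1 := G.nz_add_rl (g i) (g 0)
    rw [if_pos heq, hnz _ (hB i), heq, hwt] at h1
    have h2 := G.rl_right_unique _ _ _ (h.rl_ne_zero i) (show G.rl (g i) (g 0) ≠ 0 by omega)
    have := h.inj _ (by omega) _ h.pos h2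
    omega
  let u : V → ℤ[X] := ∑ i ∈ Finset.range m,
    (-(-X : ℤ[X]) ^ (i + 1) * (G.wt (G.tgt (g i)) : ℤ[X])) • Pi.single (G.tgt (g i)) (1 : ℤ[X])
  have hright : ∀ w, G.rightMatrix B (g 0) w * (1 - (-X) ^ (m + 1)) =
      (u ᵥ* G.cartanMatrix B) w - (-X) ^ (m + 1) * G.cartanMatrix B (G.src (g 0)) w := by
    intro w
    have h1 := h.rightMatrix_apply_zero hB (m + 1) w
    rw [Finset.sum_range_succ, htgt, hwt, h.period] at h1
    have h2 : (u ᵥ* G.cartanMatrix B) w = ∑ i ∈ Finset.range m, (-(-X : ℤ[X]) ^ (i + 1) *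
      (G.wt (G.tgt (g i)) : ℤ[X])) * G.cartanMatrix B (G.tgt (g i)) w := by
      simp only [u, Matrix.sum_vecMul, Finset.sum_apply, Matrix.smul_vecMul,
        Matrix.single_one_vecMul, Pi.smul_apply, smul_eq_mul, Matrix.row]
    rw [h2]
    push_cast at h1
    linear_combination h1
  have hleft : ∀ v, G.leftMatrix B v (g 0) = if v = G.src (g 0) then 1 else 0 := by
    intro v
    rw [leftMatrix_eq, Matrix.add_apply, Matrix.smul_apply, Matrix.mul_apply,
      Finset.sum_eq_zero, smul_zero, add_zero]
    · simp [srcMatrix, hB 0, eq_comm]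
    · intro b _
      by_cases hb : b ∈ B <;> simp [stepMatrix, hb, hnz]
  have hmul : diagonal (fun v => D v * if v = G.src (g 0) then 1 - (-X) ^ (m + 1) else 1) *
        G.cartanMatrix (B.erase (g 0)) = diagonal D *
      ((1 - vecMulVec (Pi.single (G.src (g 0)) 1) u) * G.cartanMatrix B) := by
    rw [← diagonal_mul_diagonal, Matrix.mul_assoc, cartanMatrix_erase]
    congr 1
    refine Matrix.ext fun v w => ?_
    rw [Matrix.diagonal_mul, Matrix.sub_apply, vecMulVec_apply, Matrix.sub_mul, Matrix.one_mul,
      Matrix.sub_apply, vecMulVec_mul, vecMulVec_apply, hleft]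
    by_cases hv : v = G.src (g 0)
    · subst hv
      simp only [if_true, Pi.single_eq_same]
      linear_combination -hright w
    · simp [hv]
  rw [hmul, ← Matrix.mul_assoc, diagonal_mul_one_sub_vecMulVec, Matrix.mul_assoc]
  · apply UnimodEquiv.mul_left
    rw [det_one_sub_vecMulVec, dotProduct_single_one]
    have : u (G.src (g 0)) = 0 := by
      simp only [u, Finset.sum_apply]
      refine Finset.sum_eq_zero fun i hi => ?_
      simp [Pi.single_eq_of_ne (hne i (Finset.mem_range.1 hi)).symm]
    rw [this, sub_zero]
  · intro v hv
    by_cases h : v = G.src (g 0)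
    · exact h ▸ (hD _ (hB 0)).1
    · simp [h] at hv
  · intro v hv
    simp only [u, Finset.sum_apply] at hv
    obtain ⟨i, -, hi⟩ := Finset.exists_ne_zero_of_sum_ne_zero hv
    by_cases h : v = G.tgt (g i)
    · exact h ▸ (hD _ (hB i)).2
    · simp [h] at hi

theorem IsCycleSeq.unimodEquiv_sdiff (h : G.IsCycleSeq g k) (hB : ∀ i, g i ∈ B)
    (D : V → ℤ[X]) (n : ℕ) (hn : n < k) :
    UnimodEquiv (diagonal D * G.cartanMatrix (B.erase (g 0)))
      (diagonal D * G.cartanMatrix (B \ (Finset.range (n + 1)).image g)) := by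
  induction n with
  | zero => simpa [← Finset.erase_eq] using UnimodEquiv.refl _
  | succ n ih =>
    refine (ih (by omega)).trans ?_
    have h1 : B \ (Finset.range (n + 1 + 1)).image g =
        (B \ (Finset.range (n + 1)).image g).erase (g (n + 1)) := by
      rw [Finset.range_add_one, Finset.image_insert, Finset.sdiff_insert]
    rw [h1]
    apply unimodEquiv_erase_of_no_predecessor
    · rw [Finset.mem_sdiff]
      refine ⟨hB _, fun hmem => ?_⟩
      obtain ⟨i, hi, heq⟩ := Finset.mem_image.1 hmem
      have hi' := Finset.mem_range.1 hi
      have := h.inj i (by omega) (n + 1) hn heq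
      omega
    · intro b hb
      by_contra hne
      have h2 := G.rl_left_unique _ _ _ hne (h.rl_ne_zero n)
      exact (Finset.mem_sdiff.1 hb).2
        (h2 ▸ Finset.mem_image_of_mem g (Finset.mem_range.2 (Nat.lt_succ_self n)))

end Cycle

/-- The diagonal entry belonging to a cycle of length `n`, with `1` for `n = 0`. -/
noncomputable def diagEntry (n : ℕ) : ℤ[X] := if n = 0 then 1 else 1 - (-X) ^ n

variable (G) in
/-- The cycles of length `k` using only arrows in `B`. -/
def cycles (B : Finset A) (k : ℕ) : Set (Finset A) := {c | c ⊆ B ∧ G.IsCycle c ∧ c.card = k}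

theorem cycles_erase {a : A} (h : ∀ c, G.IsCycle c → c ⊆ B → a ∉ c) (k : ℕ) :
    G.cycles (B.erase a) k = G.cycles B k := by
  ext c
  simp only [cycles, Set.mem_ofPred_eq, Finset.subset_erase]
  constructor
  · rintro ⟨⟨h1, -⟩, h2⟩
    exact ⟨h1, h2⟩
  · rintro ⟨h1, h2⟩
    exact ⟨⟨h1, h c h2.1 h1⟩, h2⟩

theorem ncard_cycles_sdiff {c : Finset A} (hc : G.IsCycle c) (hcB : c ⊆ B) (k : ℕ) :
    (G.cycles B k).ncard = (G.cycles (B \ c) k).ncard + if c.card = k then 1 else 0 := by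
  obtain ⟨x, hx⟩ : c.Nonempty := by
    obtain ⟨g, k, hg, rfl⟩ := hc
    exact ⟨_, hg.mem_image 0⟩
  have hnot : c ∉ G.cycles (B \ c) k := fun h => (Finset.mem_sdiff.1 (h.1 hx)).2 hx
  have hsub : ∀ c', c' ≠ c → (c' ∈ G.cycles B k ↔ c' ∈ G.cycles (B \ c) k) := by
    intro c' hne
    refine ⟨fun h => ⟨fun y hy => Finset.mem_sdiff.2 ⟨h.1 hy, fun hyc => ?_⟩, h.2⟩,
      fun h => ⟨h.1.trans Finset.sdiff_subset, h.2⟩⟩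
    exact hne (h.2.1.eq_of_mem hc hy hyc)
  split_ifs with hk
  · rw [← Set.ncard_insert_of_notMem hnot]
    congr 1
    ext c'
    by_cases hne : c' = c
    · simp only [hne, Set.mem_insert_iff, true_or, iff_true]
      exact ⟨hcB, hc, hk⟩
    · simp [hne, hsub c' hne]
  · rw [add_zero]
    congr 1
    ext c'
    by_cases hne : c' = c
    · simp only [hne, hnot, iff_false]
      exact fun h => hk h.2.2
    · exact hsub c' hne

theorem exists_unimodEquiv_diagonal (B : Finset A) : ∀ D : V → ℤ[X], G.IsTrivialOn B D →
    ∃ F : V → ℕ, (∀ v, F v ≠ 0 → ∃ a ∈ B, G.src a = v) ∧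
      (∀ k, 1 ≤ k → {v | F v = k}.ncard = (G.cycles B k).ncard) ∧
      UnimodEquiv (diagonal D * G.cartanMatrix B) (diagonal fun v => D v * diagEntry (F v)) := by
  induction B using Finset.strongInduction with
  | H B ih =>
  intro D hD
  have herase : ∀ a ∈ B, (∀ c, G.IsCycle c → c ⊆ B → a ∉ c) →
      UnimodEquiv (diagonal D * G.cartanMatrix B) (diagonal D * G.cartanMatrix (B.erase a)) →
      ∃ F : V → ℕ, (∀ v, F v ≠ 0 → ∃ a ∈ B, G.src a = v) ∧
      (∀ k, 1 ≤ k → {v | F v = k}.ncard = (G.cycles B k).ncard) ∧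
      UnimodEquiv (diagonal D * G.cartanMatrix B)
        (diagonal fun v => D v * diagEntry (F v)) := by
    intro a ha hc hU
    obtain ⟨F, hF, hcard, hdiag⟩ := ih _ (Finset.erase_ssubset ha) D
      (hD.mono (Finset.erase_subset a B))
    refine ⟨F, fun v hv => ?_, fun k hk => ?_, hU.trans hdiag⟩
    · obtain ⟨b, hb, rfl⟩ := hF v hv
      exact ⟨b, Finset.mem_of_mem_erase hb, rfl⟩
    · rw [hcard k hk, cycles_erase hc]
  by_cases hsucc : ∀ a ∈ B, ∃ b ∈ B, G.rl a b ≠ 0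
  swap
  · push Not at hsucc
    obtain ⟨a, ha, h⟩ := hsucc
    refine herase a ha (fun c hc hcB hac => ?_) (unimodEquiv_erase_of_no_successor ha h hD)
    obtain ⟨y, hy, hne⟩ := hc.exists_successor hac
    exact hne (h y (hcB hy))
  by_cases hpred : ∀ a ∈ B, ∃ b ∈ B, G.rl b a ≠ 0
  swap
  · push Not at hpred
    obtain ⟨a, ha, h⟩ := hpred
    refine herase a ha (fun c hc hcB hac => ?_) (unimodEquiv_erase_of_no_predecessor ha h D)
    obtain ⟨y, hy, hne⟩ := hc.exists_predecessor hac
    exact hne (h y (hcB hy))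
  rcases B.eq_empty_or_nonempty with rfl | hne
  · refine ⟨fun _ => 0, by simp, fun k hk => ?_, ?_⟩
    · have h1 : G.cycles ∅ k = ∅ := by
        ext c
        simp only [cycles, Finset.subset_empty, Set.mem_ofPred_eq, Set.mem_empty_iff_false,
          iff_false]
        rintro ⟨rfl, -, h⟩
        simp at h
        omega
      have h2 : {v : V | 0 = k} = ∅ := by
        ext
        simp only [Set.mem_ofPred_eq, Set.mem_empty_iff_false, iff_false]
        omega
      rw [h1, h2]
      simp
    · have h1 : G.cartanMatrix ∅ = 1 := by
        have h2 : G.srcMatrix ∅ = 0 := by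
          refine Matrix.ext fun v a => ?_
          simp [srcMatrix]
        rw [cartanMatrix, h2, Matrix.zero_mul, add_zero]
      simpa [h1, diagEntry] using UnimodEquiv.refl _
  obtain ⟨p, hp, hmin⟩ := B.exists_min_image G.ht hne
  obtain ⟨g, k, hg, rfl, hgB⟩ := exists_isCycleSeq hsucc hp
  set c := (Finset.range k).image g with hc
  set D' : V → ℤ[X] := fun v => D v * if v = G.src (g 0) then 1 - (-X) ^ k else 1 with hD'
  have hcB : c ⊆ B := by
    intro y hy
    obtain ⟨i, -, rfl⟩ := Finset.mem_image.1 hy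
    exact hgB i
  have hU : UnimodEquiv (diagonal D * G.cartanMatrix B) (diagonal D' * G.cartanMatrix (B \ c)) := by
    refine (hg.unimodEquiv_erase_head hgB hmin hD).trans ?_
    have h1 := hg.unimodEquiv_sdiff hgB D' (k - 1) (Nat.sub_lt hg.pos one_pos)
    rwa [show k - 1 + 1 = k from Nat.sub_add_cancel hg.pos] at h1
  have hin : ∀ x ∈ B, G.tgt x = G.src (g 0) → x ∈ c := by
    intro x hx hxt
    have hwt := G.nz_add_rl (g (k - 1)) (g 0)
    have hrl := hg.rl_ne_zero (k - 1)
    have htgt := hg.tgt_eq_src (k - 1)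
    rw [Nat.sub_add_cancel hg.pos, hg.period] at hrl htgt
    rw [if_pos htgt, htgt] at hwt
    have h1 := G.nz_add_rl x (g 0)
    rw [if_pos hxt, hxt] at h1
    have h2 : G.nz x (g 0) = 0 := by
      by_contra hne
      have := G.ht_lt _ _ hne
      have := hmin x hx
      omega
    rw [G.rl_left_unique _ x _ (show G.rl x (g 0) ≠ 0 by omega) hrl]
    exact hg.mem_image _
  have hout : ∀ x ∈ B, G.src x = G.src (g 0) → x ∈ c := by
    intro x hx hxs
    obtain ⟨y, hy, hyx⟩ := hpred x hx
    have h1 : G.tgt y = G.src x := by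
      by_contra hne
      have := G.nz_add_rl y x
      rw [if_neg hne] at this
      omega
    obtain ⟨i, -, rfl⟩ := Finset.mem_image.1 (hin y hy (h1.trans hxs))
    rw [G.rl_right_unique _ _ _ hyx (hg.rl_ne_zero i)]
    exact hg.mem_image _
  have htriv : G.IsTrivialOn (B \ c) D' := by
    intro a ha
    obtain ⟨haB, hac⟩ := Finset.mem_sdiff.1 ha
    have h1 : G.src a ≠ G.src (g 0) := fun h => hac (hout a haB h)
    have h2 : G.tgt a ≠ G.src (g 0) := fun h => hac (hin a haB h)
    simp [hD', h1, h2, hD a haB]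
  have hssub : B \ c ⊂ B :=
    Finset.sdiff_ssubset hcB ⟨_, hg.mem_image 0⟩
  obtain ⟨F, hF, hcard, hdiag⟩ := ih _ hssub D' htriv
  have hF0 : F (G.src (g 0)) = 0 := by
    by_contra hne
    obtain ⟨a, ha, h⟩ := hF _ hne
    obtain ⟨haB, hac⟩ := Finset.mem_sdiff.1 ha
    exact hac (hout a haB h)
  refine ⟨Function.update F (G.src (g 0)) k, fun v hv => ?_, fun n hn => ?_, ?_⟩
  · by_cases h : v = G.src (g 0)
    · exact ⟨g 0, hp, h.symm⟩
    · rw [Function.update_of_ne h] at hv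
      obtain ⟨a, ha, h⟩ := hF v hv
      exact ⟨a, Finset.sdiff_subset ha, h⟩
  · rw [ncard_cycles_sdiff ⟨g, k, hg, hc⟩ hcB, ← hcard n hn, hc, hg.card_image]
    split_ifs with hk
    · have h1 : G.src (g 0) ∉ {v | F v = n} := by
        simp only [Set.mem_ofPred_eq, hF0]
        omega
      rw [← Set.ncard_insert_of_notMem h1]
      congr 1
      ext v
      by_cases h : v = G.src (g 0)
      · simp [h, hk]
      · simp [h]
    · rw [add_zero]
      congr 1
      ext v
      by_cases h : v = G.src (g 0)
      · subst h
        simp only [Function.update_self, Set.mem_ofPred_eq, hF0, hk, false_iff]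
        omega
      · simp [h]
  · convert hU.trans hdiag using 2
    ext v : 1
    by_cases h : v = G.src (g 0)
    · subst h
      simp [hD', hF0, diagEntry, hg.pos.ne']
    · simp [hD', h]

end WeightedArrows

namespace QuivRel

variable {G : QuivRel} {Sp : Finset G.V}

variable (G Sp) in
/-- Composability of two arrows whose composition is nonzero in the skewed-gentle algebra. -/
def NonzeroStep (a b : G.A) : Prop :=
  G.tgt a = G.src b ∧ (G.rel a b → G.tgt a ∈ Sp)

theorem rel_of_tgt_mem (h : (G.addLoops Sp).Gentle) {a b : G.A} (hab : G.tgt a = G.src b)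
    (ha : G.tgt a ∈ Sp) : G.rel a b := by
  by_contra hr
  have := h.1.2.2.1 (Sum.inl a) (Sum.inl b) (Sum.inr ⟨G.tgt a, ha⟩) hab hr rfl id
  cases this

theorem exists_isNonzeroPath_addLoops (p : List G.A) (hp : p.IsChain (G.NonzeroStep Sp)) :
    ∃ q : List (G.addLoops Sp).A, (G.addLoops Sp).IsNonzeroPath q ∧ p.length ≤ q.length ∧
      q.head? = p.head?.map Sum.inl := by
  induction p with
  | nil => exact ⟨[], List.isChain_nil, le_rfl, rfl⟩
  | cons a p ih =>
    cases p with
    | nil => exact ⟨[Sum.inl a], List.isChain_singleton _, le_rfl, rfl⟩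
    | cons b l =>
      rw [List.isChain_cons_cons] at hp
      obtain ⟨q, hq, hlen, hhead⟩ := ih hp.2
      obtain ⟨q, rfl⟩ : ∃ q', q = Sum.inl b :: q' := by
        cases q with
        | nil => simp at hhead
        | cons x q => exact ⟨q, congrArg (· :: q) (Option.some.inj hhead)⟩
      by_cases hr : G.rel a b
      · refine ⟨Sum.inl a :: Sum.inr ⟨G.tgt a, hp.1.2 hr⟩ :: Sum.inl b :: q, ?_, ?_, rfl⟩
        · exact List.isChain_cons_cons.2 ⟨⟨rfl, id⟩, List.isChain_cons_cons.2 ⟨⟨hp.1.1, id⟩, hq⟩⟩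
        · exact (Nat.succ_le_succ hlen).trans (Nat.succ_le_succ (Nat.le_succ _))
      · refine ⟨Sum.inl a :: Sum.inl b :: q, ?_, ?_, rfl⟩
        · exact List.isChain_cons_cons.2 ⟨⟨hp.1.1, hr⟩, hq⟩
        · exact Nat.succ_le_succ hlen

theorem exists_height (h : (G.addLoops Sp).FinDim) :
    ∃ ht : G.A → ℕ, ∀ a b, G.NonzeroStep Sp a b → ht a < ht b := by
  classical
  obtain ⟨N, hN⟩ := h
  let P : G.A → ℕ → Prop := fun a n =>
    ∃ p : List G.A, (p ++ [a]).IsChain (G.NonzeroStep Sp) ∧ p.length = n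
  refine ⟨fun a => Nat.findGreatest (P a) N, fun a b hab => ?_⟩
  obtain ⟨p, hp, hlen⟩ : P a (Nat.findGreatest (P a) N) :=
    Nat.findGreatest_spec (Nat.zero_le N) ⟨[], List.isChain_singleton _, rfl⟩
  have hp' : (p ++ [a] ++ [b]).IsChain (G.NonzeroStep Sp) := by
    rw [List.isChain_append]
    exact ⟨hp, List.isChain_singleton _, by simpa using hab⟩
  refine Nat.lt_of_succ_le (Nat.le_findGreatest ?_ ⟨p ++ [a], hp', by simp [hlen]⟩)
  obtain ⟨q, hq, hle, -⟩ := exists_isNonzeroPath_addLoops _ hp'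
  rw [List.length_append, List.length_append, hlen] at hle
  exact (Nat.le_succ _).trans (hle.trans (hN q hq))

open Classical in
variable (G Sp) in
/-- The arrows of a gentle quiver, with special vertices of weight two. -/
noncomputable def weightedArrows (hG : G.Gentle) (hg : (G.addLoops Sp).Gentle)
    (hf : (G.addLoops Sp).FinDim) : WeightedArrows G.V G.A where
  src := G.src
  tgt := G.tgt
  wt v := if v ∈ Sp then 2 else 1
  nz a b := if G.NonzeroStep Sp a b then 1 else 0
  rl a b := if G.rel a b then 1 else 0
  ht := Classical.choose (exists_height hf)
  nz_add_rl a b := by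
    by_cases hab : G.tgt a = G.src b
    · by_cases ha : G.tgt a ∈ Sp
      · have := rel_of_tgt_mem hg hab ha
        simp [NonzeroStep, hab, this, hab ▸ ha]
      · have ha' : G.src b ∉ Sp := hab ▸ ha
        by_cases hr : G.rel a b <;> simp [NonzeroStep, hab, hr, ha']
    · have hr : ¬ G.rel a b := fun h => hab (G.rel_comp _ _ h)
      simp [NonzeroStep, hab, hr]
  ht_lt a b h := Classical.choose_spec (exists_height hf) a b (by by_contra h'; simp [h'] at h)
  rl_le_one a b := by split_ifs <;> simp
  rl_right_unique a b c hb hc := hG.2.1 a b c (by simpa using hb) (by simpa using hc)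
  rl_left_unique a b c hb hc := hG.2.2 a b c (by simpa using hb) (by simpa using hc)

open Classical in
variable (G Sp) in
/-- The underlying paths in `Q`, with one arrow removed, of nonzero paths in the skewed-gentle
algebra, with given first arrow and end vertex. -/
noncomputable def tailPaths : ℕ → G.A → G.V → Finset (List G.A)
  | 0, a, w => if G.tgt a = w then {[]} else ∅
  | m + 1, a, w => (Finset.univ.filter (G.NonzeroStep Sp a)).biUnion fun b =>
      (tailPaths m b w).image (b :: ·)

theorem mem_tailPaths {m : ℕ} {a : G.A} {w : G.V} {p : List G.A} :
    p ∈ G.tailPaths Sp m a w ↔ (a :: p).IsChain (G.NonzeroStep Sp) ∧ p.length = m ∧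
      ∀ x ∈ (a :: p).getLast?, G.tgt x = w := by
  induction m generalizing a p with
  | zero =>
    cases p with
    | nil => by_cases h : G.tgt a = w <;> simp [tailPaths, h]
    | cons b p => by_cases h : G.tgt a = w <;> simp [tailPaths, h]
  | succ m ih =>
    cases p with
    | nil => simp [tailPaths]
    | cons b p =>
      simp only [tailPaths, Finset.mem_biUnion, Finset.mem_filter, Finset.mem_univ, true_and,
        Finset.mem_image, List.cons.injEq, List.isChain_cons_cons, List.length_cons,
        Nat.add_right_cancel_iff, List.getLast?_cons_cons]
      constructor
      · rintro ⟨b', hab, p', hp, rfl, rfl⟩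
        obtain ⟨h1, h2, h3⟩ := ih.1 hp
        exact ⟨⟨hab, h1⟩, h2, h3⟩
      · rintro ⟨⟨hab, h1⟩, h2, h3⟩
        exact ⟨b, hab, p, ih.2 ⟨h1, h2, h3⟩, rfl, rfl⟩

open Classical in
variable (G Sp) in
/-- The underlying paths in `Q` of nonzero paths of length `m + 1` in the skewed-gentle algebra,
with given start and end vertex. -/
noncomputable def basePaths (m : ℕ) (u w : G.V) : Finset (List G.A) :=
  (Finset.univ.filter fun a => G.src a = u).biUnion fun a => (G.tailPaths Sp m a w).image (a :: ·)

theorem mem_basePaths {m : ℕ} {u w : G.V} {p : List G.A} :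
    p ∈ G.basePaths Sp m u w ↔ p.IsChain (G.NonzeroStep Sp) ∧ p.length = m + 1 ∧
      (∀ x ∈ p.head?, G.src x = u) ∧ ∀ x ∈ p.getLast?, G.tgt x = w := by
  simp only [basePaths, Finset.mem_biUnion, Finset.mem_filter, Finset.mem_univ, true_and,
    Finset.mem_image]
  cases p with
  | nil => simp
  | cons a p =>
    constructor
    · rintro ⟨a', ha, p', hp, h⟩
      obtain ⟨rfl, rfl⟩ := List.cons.inj h
      obtain ⟨h1, h2, h3⟩ := mem_tailPaths.1 hp
      exact ⟨h1, by simp [h2], by simpa using ha, h3⟩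
    · rintro ⟨h1, h2, h3, h4⟩
      exact ⟨a, by simpa using h3, p, mem_tailPaths.2 ⟨h1, by simpa using h2, h4⟩, rfl⟩

theorem card_biUnion_image_cons {A : Type} [DecidableEq A] (s : Finset A)
    (t : A → Finset (List A)) :
    (s.biUnion fun a => (t a).image (a :: ·)).card = ∑ a ∈ s, (t a).card := by
  rw [Finset.card_biUnion]
  · exact Finset.sum_congr rfl fun a _ => Finset.card_image_of_injective _ List.cons_injective
  · intro a _ b _ hab
    rw [Function.onFun, Finset.disjoint_left]
    intro p hp hq
    obtain ⟨p', -, rfl⟩ := Finset.mem_image.1 hp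
    obtain ⟨q', -, h⟩ := Finset.mem_image.1 hq
    exact hab (List.cons.inj h).1.symm

open Polynomial Matrix

section

variable (hG : G.Gentle) (hg : (G.addLoops Sp).Gentle) (hf : (G.addLoops Sp).FinDim)

variable (G) in
/-- The incidence matrix between arrows and their end vertices. -/
noncomputable def endMatrix : Matrix G.A G.V ℤ[X] := fun a v => if G.tgt a = v then 1 else 0

theorem card_tailPaths (m : ℕ) (a : G.A) (w : G.V) :
    ((G.tailPaths Sp m a w).card : ℤ[X]) =
      (((G.weightedArrows Sp hG hg hf).stepMatrix Finset.univ) ^ m * G.endMatrix) a w := by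
  classical
  induction m generalizing a with
  | zero => by_cases h : G.tgt a = w <;> simp [tailPaths, endMatrix, h]
  | succ m ih =>
    rw [tailPaths]
    rw [card_biUnion_image_cons, pow_succ', Matrix.mul_assoc, Matrix.mul_apply, Nat.cast_sum,
      Finset.sum_filter]
    refine Finset.sum_congr rfl fun b _ => ?_
    rw [ih]
    simp [WeightedArrows.stepMatrix, weightedArrows]

theorem card_basePaths (m : ℕ) (u w : G.V) :
    ((G.basePaths Sp m u w).card : ℤ[X]) =
      ((G.weightedArrows Sp hG hg hf).srcMatrix Finset.univ *
        ((G.weightedArrows Sp hG hg hf).stepMatrix Finset.univ ^ m * G.endMatrix)) u w := by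
  classical
  rw [basePaths, card_biUnion_image_cons, Matrix.mul_apply, Nat.cast_sum, Finset.sum_filter]
  refine Finset.sum_congr rfl fun a _ => ?_
  rw [card_tailPaths hG hg hf]
  simp [WeightedArrows.srcMatrix, weightedArrows]

end
end QuivRel

namespace QuivRel

variable {G : QuivRel} {Sp : Finset G.V}

theorem hatA_ext {x y : G.hatA Sp} (h1 : x.1.1 = y.1.1) (h2 : x.1.2.1 = y.1.2.1)
    (h3 : x.1.2.2 = y.1.2.2) : x = y :=
  Subtype.ext (Prod.ext h1 (Prod.ext h2 h3))

theorem EqvGen_MeshSwap_map {p q : List (G.hatA Sp)} (h : Relation.EqvGen (G.MeshSwap Sp) p q) :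
    p.map (·.1.1) = q.map (·.1.1) := by
  induction h with
  | rel p q h =>
    obtain ⟨l₁, l₂, u, v, u', v', rfl, rfl, h1, h2, -⟩ := h
    simp [h1, h2]
  | refl => rfl
  | symm _ _ _ ih => exact ih.symm
  | trans _ _ _ _ _ ih ih' => exact ih.trans ih'

theorem EqvGen_MeshSwap_cons {p q : List (G.hatA Sp)}
    (h : Relation.EqvGen (G.MeshSwap Sp) p q) (x : G.hatA Sp) :
    Relation.EqvGen (G.MeshSwap Sp) (x :: p) (x :: q) := by
  induction h with
  | rel p q h =>
    obtain ⟨l₁, l₂, u, v, u', v', rfl, rfl, h⟩ := h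
    exact .rel _ _ ⟨x :: l₁, l₂, u, v, u', v', rfl, rfl, h⟩
  | refl => exact .refl _
  | symm _ _ _ ih => exact .symm _ _ ih
  | trans _ _ _ _ _ ih ih' => exact .trans _ _ _ ih ih'

theorem hatQuiv_step_iff {x y : G.hatA Sp} :
    ((G.hatQuiv Sp).tgt x = (G.hatQuiv Sp).src y ∧ ¬ (G.hatQuiv Sp).rel x y) ↔
      G.NonzeroStep Sp x.1.1 y.1.1 ∧ x.1.2.2 = y.1.2.1 := by
  constructor
  · rintro ⟨h1, h2⟩
    have h3 := congrArg Subtype.val h1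
    refine ⟨⟨congrArg Prod.fst h3, fun hr => ?_⟩, congrArg Prod.snd h3⟩
    by_contra ht
    exact h2 ⟨hr, congrArg Prod.snd h3, ht⟩
  · rintro ⟨⟨h1, h2⟩, h3⟩
    exact ⟨Subtype.ext (Prod.ext h1 h3), fun hr => hr.2.2 (h2 hr.1)⟩

theorem hatQuiv_isNonzeroPath_iff {p : List (G.hatA Sp)} :
    (G.hatQuiv Sp).IsNonzeroPath p ↔
      p.IsChain fun x y => G.NonzeroStep Sp x.1.1 y.1.1 ∧ x.1.2.2 = y.1.2.1 :=
  List.IsChain.iff fun {_ _} => hatQuiv_step_iff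

theorem EqvGen_MeshSwap_of_map_eq (hg : (G.addLoops Sp).Gentle) {j : G.hatV Sp} :
    ∀ {p q : List (G.hatA Sp)} {x y : G.hatA Sp},
      (x :: p).IsChain (fun x y => G.NonzeroStep Sp x.1.1 y.1.1 ∧ x.1.2.2 = y.1.2.1) →
      (y :: q).IsChain (fun x y => G.NonzeroStep Sp x.1.1 y.1.1 ∧ x.1.2.2 = y.1.2.1) →
      (x :: p).map (·.1.1) = (y :: q).map (·.1.1) → x.1.2.1 = y.1.2.1 →
      (∀ z ∈ (x :: p).getLast?, (G.hatQuiv Sp).tgt z = j) →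
      (∀ z ∈ (y :: q).getLast?, (G.hatQuiv Sp).tgt z = j) →
      Relation.EqvGen (G.MeshSwap Sp) (x :: p) (y :: q) := by
  intro p
  induction p with
  | nil =>
    intro q x y hp hq hpq hxy hjx hjy
    cases q with
    | cons _ _ => simp at hpq
    | nil =>
      have h := (hjx x rfl).trans (hjy y rfl).symm
      rw [hatA_ext (by simpa using hpq) hxy (congrArg (fun v : G.hatV Sp => v.1.2) h)]
      exact .refl _
  | cons x' p ih =>
    intro q x y hp hq hpq hxy hjx hjy
    cases q with
    | nil => simp at hpq
    | cons y' q =>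
      rw [List.isChain_cons_cons] at hp hq
      rw [List.getLast?_cons_cons] at hjx hjy
      have hpq' := List.cons.inj hpq
      by_cases hm : x.1.2.2 = y.1.2.2
      · rw [hatA_ext hpq'.1 hxy hm]
        refine EqvGen_MeshSwap_cons (ih hp.2 hq.2 hpq'.2 ?_ hjx hjy) _
        rw [← hp.1.2, ← hq.1.2, hm]
      · have hmem : G.tgt x.1.1 ∈ Sp := by
          by_contra hn
          have hxy' : x.1.1 = y.1.1 := hpq'.1
          exact hm ((x.2.2 hn).trans (y.2.2 (hxy' ▸ hn)).symm)
        let z : G.hatA Sp := ⟨(x'.1.1, y.1.2.2, x'.1.2.2),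
          fun hn => absurd (hp.1.1.1 ▸ hmem) hn, x'.2.2⟩
        have hswap : G.MeshSwap Sp (x :: x' :: p) (y :: z :: p) :=
          ⟨[], p, x, x', y, z, rfl, rfl, hpq'.1, rfl, hxy, rfl, hp.1.2, rfl,
            rel_of_tgt_mem hg hp.1.1.1 hmem, hmem⟩
        refine .trans _ _ _ (.rel _ _ hswap)
          (EqvGen_MeshSwap_cons (ih (x := z) ?_ hq.2 hpq'.2 hq.1.2 ?_ hjy) _)
        · cases p with
          | nil => exact List.isChain_singleton _
          | cons _ _ =>
            rw [List.isChain_cons_cons] at hp ⊢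
            exact hp.2
        · cases p with
          | nil =>
            intro w hw
            obtain rfl : z = w := by simpa using hw
            exact hjx x' rfl
          | cons _ _ => exact hjx

theorem exists_hatQuiv_path {w : G.V} {t : Bool} (ht : w ∉ Sp → t = false) :
    ∀ {p : List G.A} {a : G.A} {s : Bool}, (a :: p).IsChain (G.NonzeroStep Sp) →
      (∀ x ∈ (a :: p).getLast?, G.tgt x = w) → (G.src a ∉ Sp → s = false) →
      ∃ (x : G.hatA Sp) (q : List (G.hatA Sp)),
        (x :: q).IsChain (fun x y => G.NonzeroStep Sp x.1.1 y.1.1 ∧ x.1.2.2 = y.1.2.1) ∧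
        (x :: q).map (·.1.1) = a :: p ∧ x.1.2.1 = s ∧
        ∀ z ∈ (x :: q).getLast?, (G.hatQuiv Sp).tgt z = ⟨(w, t), ht⟩ := by
  intro p
  induction p with
  | nil =>
    intro a s hp hw hs
    have haw : G.tgt a = w := hw a rfl
    refine ⟨⟨(a, s, t), hs, haw ▸ ht⟩, [], List.isChain_singleton _, rfl, rfl, ?_⟩
    intro z hz
    obtain rfl := Option.some.inj hz
    exact Subtype.ext (Prod.ext haw rfl)
  | cons b p ih =>
    intro a s hp hw hs
    rw [List.isChain_cons_cons] at hp
    rw [List.getLast?_cons_cons] at hw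
    obtain ⟨x, q, hq, hmap, hx, hz⟩ := ih (s := false) hp.2 hw fun _ => rfl
    refine ⟨⟨(a, s, false), hs, fun _ => rfl⟩, x :: q, ?_, ?_, rfl, ?_⟩
    · rw [List.isChain_cons_cons]
      refine ⟨⟨?_, hx.symm⟩, hq⟩
      rw [show x.1.1 = b from (List.cons.inj hmap).1]
      exact hp.1
    · rw [List.map_cons, hmap]
    · rwa [List.getLast?_cons_cons]

theorem natCard_quotient_zero (i j : (G.hatQuiv Sp).V) :
    Nat.card (Quotient (G.meshSetoid Sp
      fun p => p.length = 0 ∧ (G.hatQuiv Sp).IsNonzeroPathFrom i j p)) =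
      if i = j then 1 else 0 := by
  split_ifs with h
  · rw [Nat.card_eq_one_iff_unique]
    refine ⟨⟨fun a b => ?_⟩, ⟨Quotient.mk _ ⟨[], rfl, List.isChain_nil, nofun, nofun, fun _ => h⟩⟩⟩
    induction a using Quotient.inductionOn with | _ a
    induction b using Quotient.inductionOn with | _ b
    rw [Subtype.ext ((List.length_eq_zero_iff.1 a.2.1).trans
      (List.length_eq_zero_iff.1 b.2.1).symm)]
  · rw [Nat.card_eq_zero]
    refine Or.inl ⟨fun a => ?_⟩
    induction a using Quotient.inductionOn with | _ a
    exact h (a.2.2.2.2.2 (List.length_eq_zero_iff.1 a.2.1))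

theorem natCard_quotient_succ (hg : (G.addLoops Sp).Gentle) (m : ℕ) (i j : (G.hatQuiv Sp).V) :
    Nat.card (Quotient (G.meshSetoid Sp
      fun p => p.length = m + 1 ∧ (G.hatQuiv Sp).IsNonzeroPathFrom i j p)) =
      (G.basePaths Sp m i.1.1 j.1.1).card := by
  rw [← Nat.card_eq_finsetCard]
  have hmem : ∀ p : List (G.hatA Sp), p.length = m + 1 ∧ (G.hatQuiv Sp).IsNonzeroPathFrom i j p →
      p.map (·.1.1) ∈ G.basePaths Sp m i.1.1 j.1.1 := by
    rintro p ⟨hlen, hp, hi, hj, -⟩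
    refine mem_basePaths.2 ⟨?_, by rw [List.length_map, hlen], ?_, ?_⟩
    · rw [List.isChain_map]
      exact (hatQuiv_isNonzeroPath_iff.1 hp).imp fun _ _ h => h.1
    · rw [List.head?_map]
      intro a ha
      obtain ⟨x, hx, rfl⟩ := Option.mem_map.1 ha
      rw [← hi x hx]
      rfl
    · rw [List.getLast?_map]
      intro a ha
      obtain ⟨x, hx, rfl⟩ := Option.mem_map.1 ha
      rw [← hj x hx]
      rfl
  refine Nat.card_eq_of_bijective (Quotient.lift (fun p => ⟨p.1.map (·.1.1), hmem p.1 p.2⟩)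
    fun p q h => Subtype.ext (EqvGen_MeshSwap_map h)) ⟨?_, ?_⟩
  · intro a b hab
    induction a using Quotient.inductionOn with | _ a
    induction b using Quotient.inductionOn with | _ b
    refine Quotient.sound ?_
    revert hab
    obtain ⟨p, hlen, hp, hi, hj, -⟩ := a
    obtain ⟨q, hlen', hq, hi', hj', -⟩ := b
    intro hab
    cases p with
    | nil => cases hlen
    | cons x p =>
      cases q with
      | nil => cases hlen'
      | cons y q =>
        refine EqvGen_MeshSwap_of_map_eq hg (hatQuiv_isNonzeroPath_iff.1 hp)
          (hatQuiv_isNonzeroPath_iff.1 hq) (congrArg Subtype.val hab) ?_ hj hj'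
        exact congrArg (fun v : G.hatV Sp => v.1.2) ((hi x rfl).trans (hi' y rfl).symm)
  · rintro ⟨p, hp⟩
    obtain ⟨hc, hlen, hi, hj⟩ := mem_basePaths.1 hp
    cases p with
    | nil => cases hlen
    | cons a p =>
      have ha : G.src a = i.1.1 := hi a rfl
      obtain ⟨x, q, hq, hmap, hx, hz⟩ :=
        exists_hatQuiv_path j.2 hc hj (s := i.1.2) fun h => i.2 (ha ▸ h)
      refine ⟨Quotient.mk _ ⟨x :: q, ?_, hatQuiv_isNonzeroPath_iff.2 hq, ?_, hz, nofun⟩,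
        Subtype.ext hmap⟩
      · rw [← hlen, ← hmap, List.length_map]
      · intro y hy
        obtain rfl := Option.some.inj hy
        refine Subtype.ext (Prod.ext ?_ hx)
        rw [← ha, ← (List.cons.inj hmap).1]
        rfl

open Polynomial Matrix

theorem hatQCartan_apply (hG : G.Gentle) (hg : (G.addLoops Sp).Gentle)
    (hf : (G.addLoops Sp).FinDim) (i j : (G.hatQuiv Sp).V) :
    G.hatQCartan Sp i j = (if i = j then 1 else 0) +
      ((X : ℤ[X]) • ((G.weightedArrows Sp hG hg hf).srcMatrix Finset.univ *
        ((G.weightedArrows Sp hG hg hf).pathMatrix Finset.univ * G.endMatrix))) i.1.1 j.1.1 := by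
  set W := G.weightedArrows Sp hG hg hf with hW
  have hsupp : ∀ m, W.bound ≤ m → (G.basePaths Sp m i.1.1 j.1.1).card = 0 := by
    intro m hm
    have h := card_basePaths hG hg hf m i.1.1 j.1.1
    rw [← hW, pow_eq_zero_of_le hm (W.pow_bound_eq_zero fun _ _ => W.ht_lt_of_stepMatrix _),
      Matrix.zero_mul, Matrix.mul_zero, Matrix.zero_apply] at h
    exact_mod_cast h
  rw [hatQCartan, finsum_eq_sum_of_support_subset (s := Finset.range (W.bound + 1)),
    Finset.sum_range_succ', natCard_quotient_zero, add_comm]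
  · congr 1
    · split_ifs <;> simp
    · rw [WeightedArrows.pathMatrix, Matrix.sum_mul, Matrix.mul_sum, Finset.smul_sum,
        Matrix.sum_apply]
      refine Finset.sum_congr rfl fun m _ => ?_
      rw [natCard_quotient_succ hg, card_basePaths hG hg hf, _root_.smul_pow, Matrix.smul_mul,
        Matrix.mul_smul, smul_smul, Matrix.smul_apply, smul_eq_mul, pow_succ']
      ring
  · intro n hn
    by_contra hlt
    obtain ⟨m, rfl⟩ : ∃ m, n = m + 1 := ⟨n - 1, by simp at hlt; omega⟩
    refine hn ?_
    dsimp only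
    rw [natCard_quotient_succ hg, hsupp m (by simp at hlt; omega)]
    simp

end QuivRel

namespace UnimodEquiv

open Matrix

variable {m n : Type} [Fintype m] [DecidableEq m] [Fintype n] [DecidableEq n] {R : Type}
  [CommRing R]

theorem submatrix {C D : Matrix n n R} (h : UnimodEquiv C D) (e : m ≃ n) :
    UnimodEquiv (C.submatrix e e) (D.submatrix e e) := by
  obtain ⟨P, Q, hP, hQ, rfl⟩ := h
  refine ⟨P.submatrix e e, Q.submatrix e e, ?_, ?_, ?_⟩
  · rw [det_submatrix_equiv_self, hP]
  · rw [det_submatrix_equiv_self, hQ]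
  · simp only [submatrix_mul_equiv]

theorem fromBlocks_one {C D : Matrix m m R} (h : UnimodEquiv C D) :
    UnimodEquiv (fromBlocks C 0 0 (1 : Matrix n n R)) (fromBlocks D 0 0 1) := by
  obtain ⟨P, Q, hP, hQ, rfl⟩ := h
  refine ⟨fromBlocks P 0 0 1, fromBlocks Q 0 0 1, ?_, ?_, ?_⟩
  · rw [det_fromBlocks_zero₁₂, hP, det_one, one_mul]
  · rw [det_fromBlocks_zero₁₂, hQ, det_one, one_mul]
  · simp [fromBlocks_multiply]

theorem fromBlocks_of_doubling (K : Matrix m m R) (J : Matrix m n R) :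
    UnimodEquiv (fromBlocks (1 + K) (K * J) (Jᵀ * K) (1 + Jᵀ * K * J))
      (fromBlocks (1 + K * (1 + J * Jᵀ)) 0 0 1) := by
  refine ⟨fromBlocks 1 (-(K * J)) 0 1 * fromBlocks 1 0 (-Jᵀ) 1, fromBlocks 1 0 Jᵀ 1, ?_, ?_, ?_⟩
  · rw [det_mul, det_fromBlocks_zero₂₁, det_fromBlocks_zero₁₂]
    simp
  · rw [det_fromBlocks_zero₁₂]
    simp
  · simp only [fromBlocks_multiply, Matrix.mul_add, Matrix.add_mul, Matrix.mul_assoc,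
      Matrix.neg_mul, Matrix.mul_neg, Matrix.one_mul, Matrix.mul_one, Matrix.zero_mul,
      Matrix.mul_zero]
    congr 1 <;> abel

end UnimodEquiv

namespace QuivRel

open Polynomial Matrix

section

variable {G : QuivRel} {Sp : Finset G.V}

variable (G Sp) in
/-- The vertices of the covering skewed-gentle quiver are those of the quiver and a second copy
of each special vertex. -/
noncomputable def sumEquivHatV : G.V ⊕ {v : G.V // v ∈ Sp} ≃ (G.hatQuiv Sp).V :=
  Equiv.ofBijective
    (Sum.elim (fun v => ⟨(v, false), fun _ => rfl⟩) fun v => ⟨(v.1, true), fun h => absurd v.2 h⟩)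
    ⟨by
      rintro (a | a) (b | b) h
      · exact congrArg Sum.inl (congrArg Prod.fst (congrArg Subtype.val h))
      · exact absurd (congrArg Prod.snd (congrArg Subtype.val h)) Bool.false_ne_true
      · exact absurd (congrArg Prod.snd (congrArg Subtype.val h)).symm Bool.false_ne_true
      · exact congrArg Sum.inr (Subtype.ext (congrArg Prod.fst (congrArg Subtype.val h))),
    by
      rintro ⟨⟨v, _ | _⟩, h⟩
      · exact ⟨Sum.inl v, rfl⟩
      · refine ⟨Sum.inr ⟨v, ?_⟩, rfl⟩
        by_contra hv
        exact absurd (h hv).symm Bool.false_ne_true⟩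

theorem hatQCartan_submatrix (hG : G.Gentle) (hg : (G.addLoops Sp).Gentle)
    (hf : (G.addLoops Sp).FinDim) :
    ∃ (K : Matrix G.V G.V ℤ[X]) (J : Matrix G.V {v : G.V // v ∈ Sp} ℤ[X]),
      (G.hatQCartan Sp).submatrix (G.sumEquivHatV Sp) (G.sumEquivHatV Sp) =
        fromBlocks (1 + K) (K * J) (Jᵀ * K) (1 + Jᵀ * K * J) ∧
      (G.weightedArrows Sp hG hg hf).cartanMatrix Finset.univ = 1 + K * (1 + J * Jᵀ) := by
  set W := G.weightedArrows Sp hG hg hf with hW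
  set J : Matrix G.V {v : G.V // v ∈ Sp} ℤ[X] := of fun v s => if v = s.1 then 1 else 0 with hJ
  set K := (X : ℤ[X]) • (W.srcMatrix Finset.univ * (W.pathMatrix Finset.univ * G.endMatrix))
    with hK
  have hL : ∀ {n : Type} (L : Matrix n G.V ℤ[X]) u s, (L * J) u s = L u s.1 := by
    intro n L u s
    simp [Matrix.mul_apply, hJ]
  have hR : ∀ s w, (Jᵀ * K) s w = K s.1 w := by
    intro s w
    simp [Matrix.mul_apply, hJ]
  have hent := fun i j => hatQCartan_apply (Sp := Sp) hG hg hf i j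
  refine ⟨K, J, ?_, ?_⟩
  · ext i j : 2
    rw [submatrix_apply, hent, ← hW, ← hK]
    simp only [EmbeddingLike.apply_eq_iff_eq]
    rcases i with u | s <;> rcases j with w | t
    · simp only [fromBlocks_apply₁₁, Matrix.add_apply, Matrix.one_apply, Sum.inl.injEq]
      rfl
    · simp only [fromBlocks_apply₁₂, hL, reduceCtorEq, if_false, zero_add]
      rfl
    · simp only [fromBlocks_apply₂₁, hR, reduceCtorEq, if_false, zero_add]
      rfl
    · simp only [fromBlocks_apply₂₂, Matrix.add_apply, Matrix.one_apply, Sum.inr.injEq, hL, hR]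
      rfl
  · have htgt : W.tgtMatrix Finset.univ = G.endMatrix * (1 + J * Jᵀ) := by
      ext a v : 2
      rw [Matrix.mul_apply, Finset.sum_eq_single (G.tgt a) _ (by simp)]
      · have hJJ : (J * Jᵀ) (G.tgt a) v = if G.tgt a = v ∧ v ∈ Sp then 1 else 0 := by
          rw [Matrix.mul_apply]
          split_ifs with h
          · rw [Finset.sum_eq_single ⟨v, h.2⟩ _ (by simp)]
            · simp [hJ, h.1]
            · intro s _ hs
              have : v ≠ s.1 := fun hvs => hs (Subtype.ext hvs.symm)
              simp [hJ, this]
          · refine Finset.sum_eq_zero fun s _ => ?_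
            have : G.tgt a ≠ s.1 ∨ v ≠ s.1 := by
              by_contra! hc
              exact h ⟨hc.1.trans hc.2.symm, hc.2 ▸ s.2⟩
            rcases this with h' | h' <;> simp [hJ, h']
        simp only [WeightedArrows.tgtMatrix, endMatrix, Matrix.add_apply, Matrix.one_apply, hJJ]
        by_cases hav : G.tgt a = v
        · by_cases hv : v ∈ Sp <;> simp [hW, weightedArrows, hav, hv, one_add_one_eq_two]
        · simp [hW, weightedArrows, hav]
      · intro v' _ hv'
        simp [endMatrix, hv'.symm]
    rw [WeightedArrows.cartanMatrix, WeightedArrows.rightMatrix, htgt, hK]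
    simp only [Matrix.mul_smul, Matrix.smul_mul, Matrix.mul_assoc]

end

section

variable {G : QuivRel} {Sp : Finset G.V} {hG : G.Gentle} {hg : (G.addLoops Sp).Gentle}
  {hf : (G.addLoops Sp).FinDim}

theorem weightedArrows_rl_ne_zero {a b : G.A} :
    (G.weightedArrows Sp hG hg hf).rl a b ≠ 0 ↔ G.rel a b := by
  simp [weightedArrows]

theorem IsMinZeroCycle.isCycleSeq {p : List G.A} (h : G.IsMinZeroCycle p) :
    (G.weightedArrows Sp hG hg hf).IsCycleSeq
      (fun i => p.get ⟨i % p.length, Nat.mod_lt _ (List.length_pos_iff.2 h.1.1)⟩) p.length := by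
  refine ⟨List.length_pos_iff.2 h.1.1, fun i => weightedArrows_rl_ne_zero.2 ?_, ?_, ?_⟩
  · convert h.1.2 ⟨i % p.length, Nat.mod_lt _ (List.length_pos_iff.2 h.1.1)⟩ using 3
    simp [Nat.add_mod]
  · simp
  · intro i hi j hj hij
    have := h.2.getElem_inj_iff.1 hij
    rwa [Nat.mod_eq_of_lt hi, Nat.mod_eq_of_lt hj] at this

theorem IsMinZeroCycle.toFinset_eq {p : List G.A} (h : G.IsMinZeroCycle p) :
    p.toFinset = (Finset.range p.length).image
      fun i => p.get ⟨i % p.length, Nat.mod_lt _ (List.length_pos_iff.2 h.1.1)⟩ := by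
  ext a
  simp only [List.mem_toFinset, Finset.mem_image, Finset.mem_range]
  constructor
  · intro ha
    obtain ⟨i, hi, rfl⟩ := List.getElem_of_mem ha
    exact ⟨i, hi, by simp [Nat.mod_eq_of_lt hi]⟩
  · rintro ⟨i, -, rfl⟩
    exact List.get_mem _ _

theorem IsMinZeroCycle.isRotated (hG : G.Gentle) (hg : (G.addLoops Sp).Gentle)
    (hf : (G.addLoops Sp).FinDim) {p q : List G.A} (hp : G.IsMinZeroCycle p)
    (hq : G.IsMinZeroCycle q) (hlen : p.length = q.length) (h : p.toFinset = q.toFinset) :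
    p ~r q := by
  have hpos := List.length_pos_iff.2 hp.1.1
  have h0 : p[0] ∈ q := by
    rw [← List.mem_toFinset, ← h, List.mem_toFinset]
    exact List.getElem_mem _
  obtain ⟨j, hj, hjp⟩ := List.getElem_of_mem h0
  have hseq := (hp.isCycleSeq (hG := hG) (hg := hg) (hf := hf)).apply_add_eq
    (hq.isCycleSeq (hG := hG) (hg := hg) (hf := hf)) (i := 0) (j := j)
    (by simp [Nat.mod_eq_of_lt hj, hjp])
  refine List.IsRotated.symm ⟨j, List.ext_getElem (by simp [hlen]) fun i hi hi' => ?_⟩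
  have := hseq i
  rw [List.getElem_rotate]
  simp only [zero_add, List.get_eq_getElem, Nat.mod_eq_of_lt hi'] at this
  simp only [this, add_comm]

theorem isMinZeroCycle_of_isCycleSeq {g : ℕ → G.A} {k : ℕ}
    (h : (G.weightedArrows Sp hG hg hf).IsCycleSeq g k) :
    G.IsMinZeroCycle ((List.range k).map g) := by
  refine ⟨⟨by simpa using h.pos.ne', fun i => ?_⟩, ?_⟩
  · have hi : (i : ℕ) < k := by simpa using i.2
    have h1 := weightedArrows_rl_ne_zero.1 (h.rl_ne_zero i)
    simp only [List.get_eq_getElem, List.getElem_map, List.getElem_range, List.length_map,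
      List.length_range]
    rcases Nat.lt_or_ge (i + 1) k with hlt | hge
    · rwa [Nat.mod_eq_of_lt hlt]
    · have hik : (i : ℕ) + 1 = k := by omega
      rw [hik, h.period] at h1
      rwa [hik, Nat.mod_self]
  · rw [List.nodup_map_iff_inj_on List.nodup_range]
    intro i hi j hj
    exact h.inj i (List.mem_range.1 hi) j (List.mem_range.1 hj)

theorem numCycles_eq (hG : G.Gentle) (hg : (G.addLoops Sp).Gentle)
    (hf : (G.addLoops Sp).FinDim) (k : ℕ) :
    G.numCycles k = ((G.weightedArrows Sp hG hg hf).cycles Finset.univ k).ncard := by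
  rw [← Nat.card_coe_set_eq]
  have hmem : ∀ p : List G.A, G.IsMinZeroCycle p ∧ p.length = k →
      p.toFinset ∈ (G.weightedArrows Sp hG hg hf).cycles Finset.univ k := by
    rintro p ⟨hp, hk⟩
    refine ⟨Finset.subset_univ _, ⟨_, _, hp.isCycleSeq, hp.toFinset_eq⟩, ?_⟩
    rw [List.toFinset_card_of_nodup hp.2, hk]
  refine Nat.card_eq_of_bijective (Quotient.lift (fun p => ⟨p.1.toFinset, hmem p.1 p.2⟩)
    fun p q h => Subtype.ext (List.toFinset_eq_of_perm _ _ (List.IsRotated.perm h))) ⟨?_, ?_⟩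
  · intro a b hab
    induction a using Quotient.inductionOn with | _ a
    induction b using Quotient.inductionOn with | _ b
    exact Quotient.sound (a.2.1.isRotated hG hg hf b.2.1 (a.2.2.trans b.2.2.symm)
      (congrArg Subtype.val hab))
  · rintro ⟨c, -, ⟨g, l, hgl, rfl⟩, hk⟩
    rw [hgl.card_image] at hk
    refine ⟨Quotient.mk _ ⟨(List.range l).map g, isMinZeroCycle_of_isCycleSeq hgl, by simpa⟩,
      Subtype.ext ?_⟩
    ext a
    simp

end

end QuivRel

open Polynomial in
theorem one_sub_neg_X_pow_injective : Function.Injective fun k : ℕ => (1 : ℤ[X]) - (-X) ^ k := by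
  intro k l h
  have h' : (-X : ℤ[X]) ^ k = (-X) ^ l := sub_right_injective h
  have := congrArg natDegree h'
  simpa [natDegree_pow] using this

open Polynomial in
theorem WeightedArrows.diagEntry_eq_iff {n k : ℕ} (hk : 1 ≤ k) :
    WeightedArrows.diagEntry n = 1 - (-X) ^ k ↔ n = k := by
  constructor
  · intro h
    rw [WeightedArrows.diagEntry] at h
    split_ifs at h
    · have : (-X : ℤ[X]) ^ k = 0 := by linear_combination h
      exact absurd this (pow_ne_zero _ (neg_ne_zero.2 X_ne_zero))
    · exact one_sub_neg_X_pow_injective h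
  · rintro rfl
    rw [WeightedArrows.diagEntry, if_neg (by omega)]

/-- **Theorem 2.** Let `Â = KQ̂/Î` be a skewed-gentle algebra, arising from
choosing an admissible set `Sp` of special vertices in the gentle quiver
`(Q,I)` (admissibility meaning that adding a square-zero loop at each vertex of
`Sp` again yields a gentle, in particular finite-dimensional, pair).  Let `c_k`
be the number of minimal oriented `k`-cycles in `Q` with full zero relations.
Then the `q`-Cartan matrix `C_Â(q)` is unimodularly equivalent over `ℤ[q]` to a
diagonal matrix with entries `1 - (-q)^k` with multiplicity `c_k`, `k ≥ 1`, and
all further diagonal entries equal to `1`. -/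
theorem hatQCartan_unimodEquiv_diagonal (G : QuivRel) (hG : G.Gentle) (hfd : G.FinDim)
    (Sp : Finset G.V) (hSp : (G.addLoops Sp).Gentle ∧ (G.addLoops Sp).FinDim) :
    ∃ d : (G.hatQuiv Sp).V → Polynomial ℤ,
      UnimodEquiv (G.hatQCartan Sp) (Matrix.diagonal d) ∧
      (∀ k : ℕ, 1 ≤ k →
        Nat.card {v : (G.hatQuiv Sp).V // d v = 1 - (- Polynomial.X) ^ k} = G.numCycles k) ∧
      (∀ v : (G.hatQuiv Sp).V,
        (∀ k : ℕ, 1 ≤ k → d v ≠ 1 - (- Polynomial.X) ^ k) → d v = 1) := by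
  classical
  obtain ⟨hg, hf⟩ := hSp
  set W := G.weightedArrows Sp hG hg hf with hW
  obtain ⟨F, -, hF, hU⟩ := W.exists_unimodEquiv_diagonal Finset.univ 1 fun _ _ => ⟨rfl, rfl⟩
  obtain ⟨K, J, hsub, hcart⟩ := G.hatQCartan_submatrix (Sp := Sp) hG hg hf
  set e := G.sumEquivHatV Sp
  set d : G.V ⊕ {v : G.V // v ∈ Sp} → Polynomial ℤ :=
    Sum.elim (fun v => WeightedArrows.diagEntry (F v)) 1 with hd
  have hd' : ∀ x, d x = 1 ∨ ∃ k, 1 ≤ k ∧ d x = 1 - (- Polynomial.X) ^ k := by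
    rintro (v | s)
    · by_cases hv : F v = 0
      · exact Or.inl (by simp [hd, WeightedArrows.diagEntry, hv])
      · exact Or.inr ⟨F v, Nat.one_le_iff_ne_zero.2 hv, by simp [hd, WeightedArrows.diagEntry, hv]⟩
    · exact Or.inl rfl
  refine ⟨fun v => d (e.symm v), ?_, fun k hk => ?_, fun v hv => ?_⟩
  · have h1 : UnimodEquiv ((G.hatQCartan Sp).submatrix e e) (Matrix.diagonal d) := by
      rw [hsub]
      refine (UnimodEquiv.fromBlocks_of_doubling K J).trans ?_
      rw [← hcart, hd, ← Matrix.fromBlocks_diagonal]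
      simpa [Function.comp_def] using hU.fromBlocks_one
    have h2 := h1.submatrix e.symm
    rwa [Matrix.submatrix_submatrix, Matrix.submatrix_diagonal_equiv, Equiv.self_comp_symm,
      Matrix.submatrix_id_id] at h2
  · rw [QuivRel.numCycles_eq hG hg hf, ← hF k hk, ← Nat.card_coe_set_eq]
    have hmem : ∀ v : {v | F v = k}, d (e.symm (e (Sum.inl v.1))) = 1 - (- Polynomial.X) ^ k := by
      intro v
      rw [e.symm_apply_apply]
      exact (WeightedArrows.diagEntry_eq_iff hk).2 v.2
    refine (Nat.card_eq_of_bijective (fun v => ⟨e (Sum.inl v.1), hmem v⟩) ⟨?_, ?_⟩).symm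
    · intro v w hvw
      exact Subtype.ext (Sum.inl_injective (e.injective (congrArg Subtype.val hvw)))
    · rintro ⟨x, hx⟩
      obtain ⟨v | s, rfl⟩ := e.surjective x
      · dsimp only at hx
        rw [e.symm_apply_apply] at hx
        exact ⟨⟨v, (WeightedArrows.diagEntry_eq_iff hk).1 hx⟩, rfl⟩
      · dsimp only at hx
        rw [e.symm_apply_apply] at hx
        exact absurd ((WeightedArrows.diagEntry_eq_iff (n := 0) hk).1 hx) (by omega)
  · rcases hd' (e.symm v) with h | ⟨k, hk, h⟩
    · exact h
    · exact absurd h (hv k hk)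
end

section
/- Let (Q,I) be a gentle quiver over a field K with corresponding gentle algebra A = KQ/I, let Sp be an admissible set of special vertices, and let Â = KQ̂/Î be the corresponding skewed-gentle algebra. Then det C_Â(q) = det C_A(q) = ∏_{k ≥ 1} (1 − (−q)^k)^{c_k}, where c_k is the number of minimal oriented k-cycles in Q with full zero relations; in particular, specializing q = 1, the determinants of the ordinary Cartan matrices coincide: det C_Â = det C_A. -/
section PartialPermutation

open Equiv.Perm Matrix

variable {A : Type*} [Fintype A] [DecidableEq A] {R : Type*} [CommRing R]

/-- The identity matrix plus the entries `w a` at the positions `(a, σ a)` with `a` moved by `σ`. -/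
def onePlusSupport (σ : Equiv.Perm A) (w : A → R) : Matrix A A R := fun a b =>
  (1 : Matrix A A R) a b + if σ a ≠ a ∧ σ a = b then w a else 0

lemma onePlusSupport_mul {σ τ : Equiv.Perm A} (h : σ.Disjoint τ) (w : A → R) :
    onePlusSupport (σ * τ) w = onePlusSupport σ w * onePlusSupport τ w := by
  have key : ∀ ρ : Equiv.Perm A, onePlusSupport ρ w =
      1 + Matrix.of fun a b => if ρ a ≠ a ∧ ρ a = b then w a else 0 := fun ρ => rfl
  rw [key σ, key τ, key (σ * τ), mul_add, mul_one, add_mul, one_mul, add_assoc]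
  congr 1
  ext a b
  simp only [Matrix.add_apply, Matrix.mul_apply, Matrix.of_apply]
  rw [Finset.sum_eq_zero, add_zero]
  · rcases h a with ha | ha
    · have : σ (τ a) = τ a := by
        rcases h (τ a) with h1 | h1
        · exact h1
        · have := τ.injective h1
          rw [this, ha]
      simp [ha, this]
    · simp [ha]
  · intro c _
    by_cases h1 : σ a ≠ a ∧ σ a = c
    · have : τ c = c := by
        rcases h c with h2 | h2
        · exact absurd (σ.injective (h1.2.trans h2.symm)) (fun h3 => h1.1 (h3 ▸ h2))
        · exact h2
      simp [this]
    · simp [h1]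

lemma det_onePlusSupport_of_isCycle {c : Equiv.Perm A} (hc : c.IsCycle) (w : A → R) :
    (onePlusSupport c w).det = 1 - ∏ a ∈ c.support, -w a := by
  rw [← Matrix.det_transpose, Matrix.det_apply]
  have hne : (1 : Equiv.Perm A) ≠ c := hc.ne_one.symm
  rw [← Finset.sum_subset (Finset.subset_univ {1, c}), Finset.sum_pair hne]
  · rw [sub_eq_add_neg]
    congr 1
    · simp only [Equiv.Perm.sign_one, one_smul, coe_one, id_eq, transpose_apply, onePlusSupport]
      refine Finset.prod_eq_one fun a _ => ?_
      rw [Matrix.one_apply_eq, if_neg (fun h => h.1 h.2), add_zero]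
    · rw [hc.sign, Finset.prod_neg, ← Finset.prod_subset (Finset.subset_univ c.support)]
      · rw [Units.smul_def, zsmul_eq_mul, ← neg_mul]
        congr 1
        · simp
        · refine Finset.prod_congr rfl fun a ha => ?_
          have := mem_support.1 ha
          simp [onePlusSupport, this, Ne.symm this]
      · intro a _ ha
        have := notMem_support.1 ha
        simp [onePlusSupport, this]
  · intro τ _ hτ
    simp only [Finset.mem_insert, Finset.mem_singleton, not_or] at hτ
    by_contra hprod
    have hall : ∀ a, onePlusSupport c w a (τ a) ≠ 0 := by
      intro a ha
      refine hprod ?_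
      rw [Finset.prod_eq_zero (Finset.mem_univ a) (by simpa using ha), smul_zero]
    have hor : ∀ a, τ a = a ∨ τ a = c a := by
      intro a
      by_contra! hcon
      exact hall a (by simp [onePlusSupport, Ne.symm hcon.1, Ne.symm hcon.2])
    have hfix : ∀ a, c a ≠ a → τ (c a) = c a → τ a = a := by
      intro a h1 h2
      rcases hor a with h3 | h3
      · exact h3
      · exact absurd (τ.injective (h2.trans h3.symm)) h1
    by_cases hex : ∃ a, c a ≠ a ∧ τ a = a
    · obtain ⟨a, ha, hta⟩ := hex
      refine hτ.1 (Equiv.ext fun b => ?_)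
      by_cases hb : c b = b
      · rcases hor b with h | h
        · exact h
        · exact h.trans hb
      · obtain ⟨n, hn⟩ := hc.exists_pow_eq hb ha
        have : ∀ n : ℕ, ∀ b, c b ≠ b → τ ((c ^ n) b) = (c ^ n) b → τ b = b := by
          intro n
          induction n with
          | zero => intro b _ h; exact h
          | succ n ih =>
            intro b hb h
            refine hfix b hb (ih (c b) (fun h' => hb (c.injective h')) ?_)
            rwa [pow_succ, Equiv.Perm.mul_apply] at h
        exact this n b hb (by rw [hn, hta])
    · push Not at hex
      refine hτ.2 (Equiv.ext fun b => ?_)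
      by_cases hb : c b = b
      · rcases hor b with h | h
        · exact h.trans hb.symm
        · exact h
      · exact (hor b).resolve_left (hex b hb)

lemma det_onePlusSupport (σ : Equiv.Perm A) (w : A → R) :
    (onePlusSupport σ w).det = ∏ c ∈ σ.cycleFactorsFinset, (1 - ∏ a ∈ c.support, -w a) := by
  induction σ using cycle_induction_on with
  | base_one =>
    have : onePlusSupport (1 : Equiv.Perm A) w = 1 := by
      ext a b
      simp [onePlusSupport]
    simp [this]
  | base_cycles σ hσ =>
    rw [det_onePlusSupport_of_isCycle hσ, hσ.cycleFactorsFinset_eq_singleton,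
      Finset.prod_singleton]
  | induction_disjoint σ τ h _ h1 h2 =>
    rw [onePlusSupport_mul h, Matrix.det_mul, h1, h2, h.cycleFactorsFinset_mul_eq_union,
      Finset.prod_union h.disjoint_cycleFactorsFinset]

lemma det_one_add_weighted_perm (σ : Equiv.Perm A) (w : A → R) :
    (1 + Matrix.of fun a b => if σ a = b then w a else 0).det =
      (∏ a with σ a = a, (1 + w a)) *
        ∏ c ∈ σ.cycleFactorsFinset, (1 - ∏ a ∈ c.support, -w a) := by
  have : (1 + Matrix.of fun a b => if σ a = b then w a else 0 : Matrix A A R) =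
      Matrix.diagonal (fun a => if σ a = a then 1 + w a else 1) * onePlusSupport σ w := by
    ext a b
    rw [Matrix.diagonal_mul]
    by_cases ha : σ a = a
    · by_cases hab : a = b
      · subst hab
        simp [onePlusSupport, ha]
      · simp [onePlusSupport, ha, hab]
    · simp [onePlusSupport, ha]
  rw [this, Matrix.det_mul, Matrix.det_diagonal, det_onePlusSupport, Finset.prod_filter]

omit [DecidableEq A] in
/-- A relation that is functional and injective agrees on its domain with a permutation. -/
lemma exists_perm_extending {r : A → A → Prop} (h1 : ∀ a b c, r a b → r a c → b = c)
    (h2 : ∀ a b c, r b a → r c a → b = c) :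
    ∃ σ : Equiv.Perm A, ∀ a b, r a b ↔ (∃ b', r a b') ∧ σ a = b := by
  classical
  have e : ∃ e : {a // ∃ b, r a b} ≃ {b // ∃ a, r a b}, ∀ a, r a.1 (e a).1 := by
    refine ⟨Equiv.ofBijective (fun a => ⟨a.2.choose, a.1, a.2.choose_spec⟩) ⟨?_, ?_⟩,
      fun a => a.2.choose_spec⟩
    · intro a b hab
      have := congrArg Subtype.val hab
      dsimp only at this
      exact Subtype.ext (h2 _ _ _ a.2.choose_spec (this ▸ b.2.choose_spec))
    · rintro ⟨b, a, hab⟩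
      exact ⟨⟨a, b, hab⟩, Subtype.ext (h1 _ _ _ (Exists.choose_spec (⟨b, hab⟩ : ∃ b, r a b)) hab)⟩
  obtain ⟨e, he⟩ := e
  refine ⟨e.extendSubtype, fun a b => ⟨fun h => ⟨⟨b, h⟩, ?_⟩, ?_⟩⟩
  · rw [Equiv.extendSubtype_apply_of_mem e a ⟨b, h⟩]
    exact h1 _ _ _ (he ⟨a, b, h⟩) h
  · rintro ⟨h, rfl⟩
    rw [Equiv.extendSubtype_apply_of_mem e a h]
    exact he ⟨a, h⟩

end PartialPermutation

namespace QuivRel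

section ZeroCycles

open Equiv.Perm Polynomial

variable {G : QuivRel}

lemma rel_formPerm {p : List G.A} (hp : G.IsMinZeroCycle p) {a : G.A} (ha : a ∈ p) :
    G.rel a (p.formPerm a) := by
  obtain ⟨i, hi, rfl⟩ := List.getElem_of_mem ha
  rw [List.formPerm_apply_getElem p hp.2 i hi]
  exact hp.1.2 ⟨i, hi⟩

lemma support_formPerm_of_two_le {α : Type*} [Fintype α] [DecidableEq α] {p : List α}
    (hp : p.Nodup) (h : 2 ≤ p.length) : p.formPerm.support = p.toFinset := by
  refine List.support_formPerm_of_nodup p hp ?_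
  rintro x rfl
  simp at h

lemma numCycles_one : G.numCycles 1 = Nat.card {a : G.A // G.rel a a} := by
  refine (Nat.card_congr (Equiv.ofBijective
    (fun a : {a : G.A // G.rel a a} => (Quotient.mk _ ⟨[a.1], ⟨⟨by simp, ?_⟩, by simp⟩, rfl⟩ :
      Quotient (G.cycleSetoid (fun p => G.IsMinZeroCycle p ∧ p.length = 1)))) ⟨?_, ?_⟩)).symm
  · rintro ⟨i, hi⟩
    obtain rfl : i = 0 := by simpa using hi
    simpa using a.2
  · intro a b hab
    have h : [a.1] ~r [b.1] := Quotient.exact hab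
    rw [List.isRotated_singleton_iff] at h
    exact Subtype.ext (by simpa using h)
  · intro x
    induction x using Quotient.inductionOn with
    | h p =>
      obtain ⟨p, hp, hl⟩ := p
      obtain ⟨a, rfl⟩ := List.length_eq_one_iff.1 hl
      exact ⟨⟨a, by simpa using hp.1.2 ⟨0, by simp⟩⟩, rfl⟩

lemma numCycles_eq_card_cycleFactors {σ : Equiv.Perm G.A}
    (hσ : ∀ a b, G.rel a b ↔ (∃ b', G.rel a b') ∧ σ a = b) {k : ℕ} (hk : 2 ≤ k) :
    G.numCycles k = Nat.card {c : Equiv.Perm G.A // c ∈ σ.cycleFactorsFinset ∧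
      (∀ a ∈ c.support, ∃ b, G.rel a b) ∧ c.support.card = k} := by
  refine Nat.card_congr (Equiv.ofBijective (Quotient.lift
    (fun p => ⟨p.1.formPerm, ?_, ?_, ?_⟩) ?_) ⟨?_, ?_⟩)
  · obtain ⟨p, hp, rfl⟩ := p
    rw [mem_cycleFactorsFinset_iff]
    refine ⟨List.isCycle_formPerm hp.2 hk, fun a ha => ?_⟩
    rw [support_formPerm_of_two_le hp.2 hk, List.mem_toFinset] at ha
    exact ((hσ _ _).1 (rel_formPerm hp ha)).2.symm
  · obtain ⟨p, hp, rfl⟩ := p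
    intro a ha
    rw [support_formPerm_of_two_le hp.2 hk, List.mem_toFinset] at ha
    exact ⟨_, rel_formPerm hp ha⟩
  · obtain ⟨p, hp, rfl⟩ := p
    rw [support_formPerm_of_two_le hp.2 hk, List.toFinset_card_of_nodup hp.2]
  · intro p q hpq
    exact Subtype.ext (List.formPerm_eq_of_isRotated p.2.1.2 hpq)
  · intro x y
    induction x using Quotient.inductionOn with
    | h p =>
    induction y using Quotient.inductionOn with
    | h q =>
      intro h
      have h' : p.1.formPerm = q.1.formPerm := congrArg Subtype.val h
      rw [List.formPerm_eq_formPerm_iff p.2.1.2 q.2.1.2] at h'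
      refine Quotient.sound (h'.resolve_right fun h'' => ?_)
      have := p.2.2
      omega
  · rintro ⟨c, hc, hdom, hcard⟩
    rw [mem_cycleFactorsFinset_iff] at hc
    obtain ⟨x, hx⟩ := hc.1.nonempty_support
    have hform : (c.toList x).formPerm = c := by
      rw [formPerm_toList, hc.1.cycleOf_eq (mem_support.1 hx)]
    have hlen : (c.toList x).length = k := by
      rw [length_toList, hc.1.cycleOf_eq (mem_support.1 hx), hcard]
    have hnd := nodup_toList c x
    have hsupp := support_formPerm_of_two_le hnd (hlen ▸ hk)
    rw [hform] at hsupp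
    refine ⟨Quotient.mk _ ⟨c.toList x, ⟨⟨?_, fun i => ?_⟩, hnd⟩, hlen⟩, Subtype.ext hform⟩
    · intro h
      rw [h] at hlen
      simp at hlen
      omega
    · have hmem : (c.toList x).get i ∈ c.support := by
        rw [hsupp, List.mem_toFinset]
        exact List.get_mem _ _
      have hnext := List.formPerm_apply_getElem (c.toList x) hnd i.1 i.2
      rw [hform] at hnext
      rw [hσ]
      exact ⟨hdom _ hmem, (hc.2 _ hmem).symm.trans hnext⟩

lemma numCycles_eq_zero_of_card_lt {k : ℕ} (hk : Fintype.card G.A < k) : G.numCycles k = 0 := by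
  have : IsEmpty {p : List G.A // G.IsMinZeroCycle p ∧ p.length = k} :=
    ⟨fun p => by
      have := p.2.1.2.length_le_card
      have := p.2.2
      omega⟩
  have : IsEmpty (Quotient (G.cycleSetoid (fun p => G.IsMinZeroCycle p ∧ p.length = k))) :=
    ⟨fun x => x.inductionOn this.elim⟩
  exact Nat.card_of_isEmpty

open Classical in
/-- The determinant of `1 + qR`, where `R` is the matrix of the relations. -/
lemma det_one_add_rel (hG : G.Gentle) :
    (1 + Matrix.of fun a b => if G.rel a b then (X : ℤ[X]) else 0).det =
      ∏ᶠ k : ℕ, (1 - (- X) ^ (k + 1)) ^ G.numCycles (k + 1) := by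
  obtain ⟨σ, hσ⟩ := exists_perm_extending hG.2.1 hG.2.2
  set w : G.A → ℤ[X] := fun a => if ∃ b, G.rel a b then X else 0 with hw
  have hmat : (Matrix.of fun a b => if G.rel a b then (X : ℤ[X]) else 0) =
      Matrix.of fun a b => if σ a = b then w a else 0 := by
    ext1 a b
    simp only [Matrix.of_apply, hw]
    rw [hσ a b]
    by_cases h1 : σ a = b <;> by_cases h2 : ∃ b', G.rel a b' <;> simp [h1, h2]
  rw [hmat, det_one_add_weighted_perm]
  have hfin : Function.mulSupport
      (fun k => (1 - (- X : ℤ[X]) ^ (k + 1)) ^ G.numCycles (k + 1)) ⊆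
      (Finset.range (Fintype.card G.A + 1) : Finset ℕ) := by
    intro k hk
    by_contra hcon
    refine hk ?_
    simp only [Finset.coe_range, Set.mem_Iio, not_lt] at hcon
    dsimp only
    rw [numCycles_eq_zero_of_card_lt (by omega), pow_zero]
  rw [finprod_eq_prod_of_mulSupport_subset _ hfin, Finset.prod_range_succ']
  rw [mul_comm]
  congr 1
  · have hc : ∀ c ∈ σ.cycleFactorsFinset, (1 - ∏ a ∈ c.support, -w a) =
        if ∀ a ∈ c.support, ∃ b, G.rel a b then 1 - (-X : ℤ[X]) ^ c.support.card else 1 := by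
      intro c _
      split_ifs with h
      · rw [Finset.prod_congr rfl (g := fun _ => -X), Finset.prod_const]
        intro a ha
        simp only [hw, if_pos (h a ha)]
      · push Not at h
        obtain ⟨a, ha, h⟩ := h
        rw [Finset.prod_eq_zero ha, sub_zero]
        simp only [hw]
        rw [if_neg (by push Not; exact h), neg_zero]
    rw [Finset.prod_congr rfl hc, ← Finset.prod_filter]
    rw [← Finset.prod_fiberwise_of_maps_to (t := Finset.range (Fintype.card G.A))
      (g := fun c : Equiv.Perm G.A => c.support.card - 2)]
    · refine Finset.prod_congr rfl fun k _ => ?_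
      rw [numCycles_eq_card_cycleFactors hσ (by omega),
        Finset.prod_congr rfl (g := fun _ => 1 - (-X : ℤ[X]) ^ (k + 1 + 1)), Finset.prod_const]
      · congr 1
        rw [Nat.subtype_card]
        intro c
        simp only [Finset.mem_filter, and_assoc]
        refine and_congr_right fun hc => and_congr_right fun _ => ?_
        have := (mem_cycleFactorsFinset_iff.1 hc).1.two_le_card_support
        omega
      · intro c hc
        simp only [Finset.mem_filter] at hc
        have := (mem_cycleFactorsFinset_iff.1 hc.1.1).1.two_le_card_support
        rw [show c.support.card = k + 1 + 1 by omega]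
    · intro c hc
      simp only [Finset.mem_filter] at hc
      have := (mem_cycleFactorsFinset_iff.1 hc.1).1.two_le_card_support
      have := Finset.card_le_univ c.support
      simp only [Finset.mem_range]
      omega
  · rw [zero_add, numCycles_one, pow_one, sub_neg_eq_add]
    have : ∀ a, (1 + w a) = if ∃ b, G.rel a b then 1 + X else 1 := by
      intro a
      simp only [hw]
      split_ifs <;> simp
    simp only [this]
    rw [← Finset.prod_filter, Finset.prod_const]
    congr 1
    refine (Nat.subtype_card _ fun a => ?_).symm
    simp only [Finset.mem_filter, Finset.mem_univ, true_and]
    rw [hσ a a, and_comm]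

end ZeroCycles

end QuivRel

section ListCounting

open Polynomial

variable {A : Type*} [Fintype A]

instance finite_length_eq_and (n : ℕ) (P : List A → Prop) :
    Finite {l : List A // l.length = n ∧ P l} :=
  ((List.finite_length_eq A n).subset fun _ h => h.1).to_subtype

lemma card_length_succ (n : ℕ) (P : List A → Prop) :
    Nat.card {l : List A // l.length = n + 1 ∧ P l} =
      ∑ a, Nat.card {l : List A // l.length = n ∧ P (a :: l)} := by
  rw [← Nat.card_sigma]
  refine (Nat.card_congr (Equiv.ofBijective
    (fun x : Σ a, {l : List A // l.length = n ∧ P (a :: l)} =>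
      (⟨x.1 :: x.2.1, by simp [x.2.2.1], x.2.2.2⟩ : {l : List A // l.length = n + 1 ∧ P l}))
    ⟨?_, ?_⟩)).symm
  · rintro ⟨a, l, hl⟩ ⟨b, m, hm⟩ h
    have h' := congrArg Subtype.val h
    simp only [List.cons.injEq] at h'
    obtain ⟨rfl, rfl⟩ := h'
    rfl
  · rintro ⟨l, hl, hP⟩
    obtain ⟨a, l, rfl⟩ := List.exists_cons_of_length_eq_add_one hl
    exact ⟨⟨a, l, by simpa using hl, hP⟩, rfl⟩

omit [Fintype A] in
open Classical in
lemma card_length_zero (P : List A → Prop) :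
    Nat.card {l : List A // l.length = 0 ∧ P l} = if P [] then 1 else 0 := by
  split_ifs with h
  · have : Unique {l : List A // l.length = 0 ∧ P l} :=
      ⟨⟨⟨[], rfl, h⟩⟩, fun l => Subtype.ext (List.length_eq_zero_iff.1 l.2.1)⟩
    exact Nat.card_unique
  · have : IsEmpty {l : List A // l.length = 0 ∧ P l} :=
      ⟨fun l => h (List.length_eq_zero_iff.1 l.2.1 ▸ l.2.2)⟩
    exact Nat.card_of_isEmpty

omit [Fintype A] in
open Classical in
lemma card_length_and (n : ℕ) (c : Prop) (P : List A → Prop) :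
    Nat.card {l : List A // l.length = n ∧ c ∧ P l} =
      if c then Nat.card {l : List A // l.length = n ∧ P l} else 0 := by
  split_ifs with h <;> simp [h]

omit [Fintype A] in
lemma card_length_eq_zero {P : List A → Prop} {M n : ℕ} (hP : ∀ l, P l → l.length ≤ M)
    (hn : M < n) : Nat.card {l : List A // l.length = n ∧ P l} = 0 := by
  have : IsEmpty {l : List A // l.length = n ∧ P l} :=
    ⟨fun l => by
      have := hP _ l.2.2
      have := l.2.1
      omega⟩
  exact Nat.card_of_isEmpty

omit [Fintype A] in
lemma finsum_card_length {P : List A → Prop} {M : ℕ} (hP : ∀ l, P l → l.length ≤ M) :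
    (∑ᶠ n : ℕ, (Nat.card {l : List A // l.length = n ∧ P l} : ℤ[X]) * X ^ n) =
      ∑ n ∈ Finset.range (M + 1),
        (Nat.card {l : List A // l.length = n ∧ P l} : ℤ[X]) * X ^ n := by
  refine finsum_eq_sum_of_support_subset _ fun n hn => ?_
  by_contra hcon
  simp only [Finset.coe_range, Set.mem_Iio, not_lt] at hcon
  exact hn (by dsimp only; rw [card_length_eq_zero hP (by omega), Nat.cast_zero, zero_mul])

lemma card_eq_sum_card_length {P : List A → Prop} {M : ℕ} (hP : ∀ l, P l → l.length ≤ M) :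
    Nat.card {l : List A // P l} =
      ∑ n ∈ Finset.range (M + 1), Nat.card {l : List A // l.length = n ∧ P l} := by
  rw [Finset.sum_range, ← Nat.card_sigma]
  exact Nat.card_congr
    { toFun := fun l => ⟨⟨l.1.length, Nat.lt_succ_of_le (hP _ l.2)⟩, l.1, rfl, l.2⟩
      invFun := fun x => ⟨x.2.1, x.2.2.2⟩
      left_inv := fun l => rfl
      right_inv := by
        rintro ⟨⟨n, hn⟩, l, hl, h⟩
        dsimp only at hl
        subst hl
        rfl }

/-- If lists satisfying `P` have bounded length, their generating polynomial at `1` counts them. -/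
lemma eval_one_finsum_card_length {P : List A → Prop} {M : ℕ} (hP : ∀ l, P l → l.length ≤ M) :
    (∑ᶠ n : ℕ, (Nat.card {l : List A // l.length = n ∧ P l} : ℤ[X]) * X ^ n).eval 1 =
      (Nat.card {l : List A // P l} : ℤ) := by
  rw [finsum_card_length hP, card_eq_sum_card_length hP, eval_finsetSum]
  simp

end ListCounting

section TransferDeterminant

open Polynomial Matrix

/-- If `N` is nilpotent, then `1 - XN` has determinant one, its inverse being a geometric sum. -/
lemma det_one_sub_X_smul_of_pow_eq_zero {A : Type*} [Fintype A] [DecidableEq A]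
    {N : Matrix A A ℤ[X]} {M : ℕ} (hN : N ^ M = 0) : (1 - (X : ℤ[X]) • N).det = 1 := by
  have hinv : (∑ n ∈ Finset.range M, ((X : ℤ[X]) • N) ^ n) * (1 - (X : ℤ[X]) • N) = 1 := by
    rw [geom_sum_mul_neg, _root_.smul_pow, hN, smul_zero, sub_zero]
  have hunit : IsUnit (1 - (X : ℤ[X]) • N).det := by
    refine IsUnit.of_mul_eq_one
      (∑ n ∈ Finset.range M, ((X : ℤ[X]) • N) ^ n).det ?_
    rw [mul_comm, ← Matrix.det_mul, hinv, Matrix.det_one]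
  obtain ⟨r, -, hr⟩ := Polynomial.isUnit_iff.1 hunit
  have heval : (1 - (X : ℤ[X]) • N).det.eval 0 = 1 := by
    rw [← Polynomial.coe_evalRingHom, RingHom.map_det]
    have : (evalRingHom (0 : ℤ)).mapMatrix (1 - (X : ℤ[X]) • N) = 1 := by
      rw [map_sub, map_one, sub_eq_self]
      ext a b
      simp
    rw [this, Matrix.det_one]
  rw [← hr, Polynomial.eval_C] at heval
  rw [← hr, heval, map_one]

lemma det_one_add_sum_transfer {V A : Type*} [Fintype V] [DecidableEq V] [Fintype A]
    [DecidableEq A] (S : Matrix V A ℤ[X]) (T : Matrix A V ℤ[X]) {N : Matrix A A ℤ[X]} {M : ℕ}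
    (hN : N ^ M = 0) :
    (1 + ∑ n ∈ Finset.range M, (X : ℤ[X]) ^ (n + 1) • (S * N ^ n * T)).det =
      (1 + (X : ℤ[X]) • (T * S - N)).det := by
  set U := ∑ n ∈ Finset.range M, ((X : ℤ[X]) • N) ^ n with hU
  have hinv : U * (1 - (X : ℤ[X]) • N) = 1 := by
    rw [geom_sum_mul_neg, _root_.smul_pow, hN, smul_zero, sub_zero]
  have hsum : ∑ n ∈ Finset.range M, (X : ℤ[X]) ^ (n + 1) • (S * N ^ n * T) =
      S * (U * ((X : ℤ[X]) • T)) := by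
    rw [hU, Matrix.sum_mul, Matrix.mul_sum]
    refine Finset.sum_congr rfl fun n _ => ?_
    rw [_root_.smul_pow, Matrix.smul_mul, Matrix.mul_smul, Matrix.mul_smul, Matrix.mul_smul,
      smul_smul, ← pow_succ, Matrix.mul_assoc]
  rw [hsum, Matrix.det_one_add_mul_comm, ← one_mul (Matrix.det _),
    ← det_one_sub_X_smul_of_pow_eq_zero hN, ← Matrix.det_mul, mul_add, mul_one, Matrix.mul_assoc,
    ← Matrix.mul_assoc, mul_eq_one_comm.1 hinv, Matrix.one_mul, Matrix.smul_mul, smul_sub]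
  congr 1
  abel

end TransferDeterminant

namespace QuivRel

section Paths

open Polynomial

variable {G : QuivRel}

lemma isNonzeroPathFrom_nil {i j : G.V} : G.IsNonzeroPathFrom i j [] ↔ i = j := by
  refine ⟨fun h => h.2.2.2 rfl, fun h => ⟨List.isChain_nil, by simp, by simp, fun _ => h⟩⟩

lemma isNonzeroPathFrom_cons {i j : G.V} {a : G.A} {l : List G.A} :
    G.IsNonzeroPathFrom i j (a :: l) ↔
      G.src a = i ∧ (∀ b ∈ l.head?, ¬ G.rel a b) ∧ G.IsNonzeroPathFrom (G.tgt a) j l := by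
  cases l with
  | nil =>
    rw [isNonzeroPathFrom_nil]
    refine ⟨fun h => ⟨by simpa using h.2.1, by simp, by simpa using h.2.2.1⟩,
      fun h => ⟨List.isChain_singleton a, by simpa using h.1, by simpa using h.2.2, by simp⟩⟩
  | cons b l =>
    have hch : G.IsNonzeroPath (a :: b :: l) ↔
        (G.tgt a = G.src b ∧ ¬ G.rel a b) ∧ G.IsNonzeroPath (b :: l) := List.isChain_cons_cons
    simp only [IsNonzeroPathFrom, hch, List.head?_cons, List.getLast?_cons_cons, Option.mem_def,
      Option.some.injEq, forall_eq', reduceCtorEq, false_imp_iff, and_true]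
    constructor
    · rintro ⟨⟨⟨h1, h2⟩, h3⟩, h4, h5⟩
      exact ⟨h4, h2, h3, h1.symm, h5⟩
    · rintro ⟨h4, h2, h3, h1, h5⟩
      exact ⟨⟨⟨h1.symm, h2⟩, h3⟩, h4, h5⟩

variable (G)

open Classical in
/-- Incidence matrix of the start points of arrows, pulled back along a map of vertex sets. -/
noncomputable def srcMatrix {W : Type} (π : W → G.V) : Matrix W G.A ℤ[X] :=
  Matrix.of fun x a => if G.src a = π x then 1 else 0

open Classical in
/-- Incidence matrix of the end points of arrows, pulled back along a map of vertex sets. -/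
noncomputable def tgtMatrix {W : Type} (π : W → G.V) : Matrix G.A W ℤ[X] :=
  Matrix.of fun a x => if G.tgt a = π x then 1 else 0

open Classical in
/-- The matrix of nonzero paths of length two. -/
noncomputable def stepMatrix : Matrix G.A G.A ℤ[X] :=
  Matrix.of fun a b => if G.tgt a = G.src b ∧ ¬ G.rel a b then 1 else 0

/-- The `q`-Cartan matrix pulled back along a map `π` of vertex sets, keeping only those trivial
paths that lie on the diagonal. -/
noncomputable def pullbackQCartan {W : Type} (π : W → G.V) : Matrix W W ℤ[X] := fun x y =>
  ∑ᶠ n : ℕ, (Nat.card {p : List G.A //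
    p.length = n ∧ G.IsNonzeroPathFrom (π x) (π y) p ∧ (p = [] → x = y)} : ℤ[X]) * X ^ n

variable {G}

lemma card_paths_after {W : Type} (π : W → G.V) (n : ℕ) (a : G.A) (y : W) :
    (Nat.card {l : List G.A // l.length = n ∧ (∀ b ∈ l.head?, ¬ G.rel a b) ∧
      G.IsNonzeroPathFrom (G.tgt a) (π y) l} : ℤ[X]) =
      (G.stepMatrix ^ n * G.tgtMatrix π) a y := by
  classical
  induction n generalizing a with
  | zero =>
    rw [card_length_zero, pow_zero, Matrix.one_mul]
    simp [isNonzeroPathFrom_nil, tgtMatrix]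
  | succ n ih =>
    rw [card_length_succ, pow_succ', Matrix.mul_assoc, Matrix.mul_apply, Nat.cast_sum]
    refine Finset.sum_congr rfl fun b _ => ?_
    have : ∀ l : List G.A, ((∀ c ∈ (b :: l).head?, ¬ G.rel a c) ∧
        G.IsNonzeroPathFrom (G.tgt a) (π y) (b :: l)) ↔ (G.tgt a = G.src b ∧ ¬ G.rel a b) ∧
          (∀ c ∈ l.head?, ¬ G.rel b c) ∧ G.IsNonzeroPathFrom (G.tgt b) (π y) l := by
      intro l
      rw [isNonzeroPathFrom_cons, eq_comm (a := G.src b)]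
      simp only [List.head?_cons, Option.mem_def, Option.some.injEq, forall_eq']
      tauto
    simp only [this]
    rw [card_length_and, ← ih b]
    simp only [stepMatrix, Matrix.of_apply]
    split_ifs <;> simp

lemma card_paths {W : Type} (π : W → G.V) (n : ℕ) (x y : W) :
    (Nat.card {p : List G.A // p.length = n + 1 ∧ G.IsNonzeroPathFrom (π x) (π y) p ∧
      (p = [] → x = y)} : ℤ[X]) =
      (G.srcMatrix π * G.stepMatrix ^ n * G.tgtMatrix π) x y := by
  classical
  rw [card_length_succ, Matrix.mul_assoc, Matrix.mul_apply, Nat.cast_sum]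
  refine Finset.sum_congr rfl fun a _ => ?_
  simp only [isNonzeroPathFrom_cons, reduceCtorEq, false_imp_iff, and_true]
  rw [card_length_and, ← card_paths_after π n a y]
  simp only [srcMatrix, Matrix.of_apply]
  split_ifs <;> simp

lemma exists_path_of_stepMatrix_pow_ne_zero {n : ℕ} {a b : G.A}
    (h : (G.stepMatrix ^ n) a b ≠ 0) :
    ∃ l : List G.A, l.length = n ∧ G.IsNonzeroPath (a :: l) := by
  induction n generalizing a with
  | zero => exact ⟨[], rfl, List.isChain_singleton a⟩
  | succ n ih =>
    rw [pow_succ', Matrix.mul_apply] at h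
    obtain ⟨c, -, hc⟩ := Finset.exists_ne_zero_of_sum_ne_zero h
    obtain ⟨l, hl, hp⟩ := ih (right_ne_zero_of_mul hc)
    have hstep := left_ne_zero_of_mul hc
    simp only [stepMatrix, Matrix.of_apply, ne_eq, ite_eq_right_iff, one_ne_zero, imp_false,
      not_not] at hstep
    exact ⟨c :: l, by simp [hl], List.isChain_cons_cons.2 ⟨hstep, hp⟩⟩

lemma stepMatrix_pow_eq_zero {M : ℕ} (hM : ∀ p : List G.A, G.IsNonzeroPath p → p.length ≤ M) :
    G.stepMatrix ^ M = 0 := by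
  ext1 a b
  by_contra h
  obtain ⟨l, hl, hp⟩ := exists_path_of_stepMatrix_pow_ne_zero h
  have := hM _ hp
  rw [List.length_cons] at this
  omega

lemma det_pullbackQCartan (hfd : G.FinDim) {W : Type} [Fintype W] [DecidableEq W]
    (π : W → G.V) :
    (G.pullbackQCartan π).det =
      (1 + (X : ℤ[X]) • (G.tgtMatrix π * G.srcMatrix π - G.stepMatrix)).det := by
  obtain ⟨M, hM⟩ := hfd
  rw [← det_one_add_sum_transfer _ _ (stepMatrix_pow_eq_zero hM)]
  congr 1
  ext1 x y
  rw [pullbackQCartan, finsum_card_length (M := M) fun l hl => hM l hl.1.1,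
    Finset.sum_range_succ', card_length_zero, add_comm, Matrix.add_apply, Matrix.sum_apply]
  congr 1
  · by_cases hxy : x = y
    · subst hxy
      simp [isNonzeroPathFrom_nil]
    · simp [hxy]
  · refine Finset.sum_congr rfl fun n _ => ?_
    rw [card_paths, Matrix.smul_apply, smul_eq_mul, mul_comm]

lemma eval_one_pullbackQCartan (hfd : G.FinDim) {W : Type} (π : W → G.V) (x y : W) :
    (G.pullbackQCartan π x y).eval 1 = (Nat.card {p : List G.A //
      G.IsNonzeroPathFrom (π x) (π y) p ∧ (p = [] → x = y)} : ℤ) := by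
  obtain ⟨M, hM⟩ := hfd
  exact eval_one_finsum_card_length fun l hl => hM l hl.1.1

lemma isNonzeroPathFrom_and_nil_iff {i j : G.V} {p : List G.A} :
    (G.IsNonzeroPathFrom i j p ∧ (p = [] → i = j)) ↔ G.IsNonzeroPathFrom i j p :=
  and_iff_left_of_imp fun h => h.2.2.2

lemma qCartan_eq_pullbackQCartan : G.qCartan = G.pullbackQCartan id := by
  ext1 i j
  simp only [qCartan, pullbackQCartan, id, isNonzeroPathFrom_and_nil_iff]

lemma tgtMatrix_mul_srcMatrix_apply {W : Type} [Fintype W] (π : W → G.V) (a b : G.A) :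
    (G.tgtMatrix π * G.srcMatrix π) a b =
      (Nat.card {x : W // G.tgt a = π x ∧ G.src b = π x} : ℤ[X]) := by
  classical
  rw [Matrix.mul_apply, Nat.card_eq_fintype_card, Fintype.card_subtype,
    Finset.card_filter, Nat.cast_sum]
  refine Finset.sum_congr rfl fun x _ => ?_
  simp only [tgtMatrix, srcMatrix, Matrix.of_apply]
  by_cases h1 : G.tgt a = π x <;> by_cases h2 : G.src b = π x <;> simp [h1, h2]

open Classical in
lemma det_qCartan (hfd : G.FinDim) :
    G.qCartan.det =
      (1 + Matrix.of fun a b => if G.rel a b then (X : ℤ[X]) else 0).det := by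
  rw [qCartan_eq_pullbackQCartan, det_pullbackQCartan hfd]
  congr 2
  ext1 a b
  rw [Matrix.smul_apply, Matrix.sub_apply, tgtMatrix_mul_srcMatrix_apply]
  simp only [stepMatrix, Matrix.of_apply, id]
  by_cases h : G.tgt a = G.src b
  · have : Nat.card {x : G.V // G.tgt a = x ∧ G.src b = x} = 1 := by
      simp [h]
    by_cases hr : G.rel a b <;> simp [h, hr]
  · have hr : ¬ G.rel a b := fun hr => h (G.rel_comp _ _ hr)
    have : IsEmpty {x : G.V // G.tgt a = x ∧ G.src b = x} :=
      ⟨fun x => h (x.2.1.trans x.2.2.symm)⟩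
    simp [h, hr]

end Paths

end QuivRel

namespace QuivRel

section SkewedGentle

open Polynomial

variable (G : QuivRel) (Sp : Finset G.V)

/-- The quiver `Q` with only those zero relations whose middle vertex is ordinary. -/
@[reducible] def relaxed : QuivRel where
  V := G.V
  A := G.A
  src := G.src
  tgt := G.tgt
  rel a b := G.rel a b ∧ G.tgt a ∉ Sp
  rel_comp a b h := G.rel_comp a b h.1

/-- The vertex of `Q` below a vertex of `Q̂`. -/
def vertexBelow (x : (G.hatQuiv Sp).V) : (G.relaxed Sp).V := x.1.1

/-- The arrow of `Q` below an arrow of `Q̂`. -/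
def arrowBelow (x : G.hatA Sp) : (G.relaxed Sp).A := x.1.1

variable {G Sp}

lemma rel_of_mem_special (hSp : (G.addLoops Sp).Gentle) {a b : G.A} (hab : G.tgt a = G.src b)
    (ha : G.tgt a ∈ Sp) : G.rel a b := by
  by_contra h
  have := hSp.1.2.2.1 (Sum.inl a) (Sum.inl b) (Sum.inr ⟨G.tgt a, ha⟩) hab h rfl (fun h => h)
  cases this

lemma exists_addLoops_path {a : G.A} {l : List G.A}
    (h : (G.relaxed Sp).IsNonzeroPath (a :: l)) :
    ∃ l' : List (G.addLoops Sp).A, (G.addLoops Sp).IsNonzeroPath (Sum.inl a :: l') ∧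
      l.length ≤ l'.length := by
  induction l generalizing a with
  | nil => exact ⟨[], List.isChain_singleton _, le_rfl⟩
  | cons b l ih =>
    obtain ⟨⟨h1, h2⟩, h3⟩ := List.isChain_cons_cons.1 h
    obtain ⟨l', hl', hlen⟩ := ih h3
    by_cases hr : G.rel a b
    · have ha : G.tgt a ∈ Sp := by
        by_contra hcon
        exact h2 ⟨hr, hcon⟩
      refine ⟨Sum.inr ⟨G.tgt a, ha⟩ :: Sum.inl b :: l', ?_, Nat.le_succ_of_le (Nat.succ_le_succ hlen)⟩
      exact List.isChain_cons_cons.2 ⟨⟨rfl, fun h => h⟩,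
        List.isChain_cons_cons.2 ⟨⟨h1, fun h => h⟩, hl'⟩⟩
    · exact ⟨Sum.inl b :: l', List.isChain_cons_cons.2 ⟨⟨h1, hr⟩, hl'⟩, Nat.succ_le_succ hlen⟩

lemma finDim_relaxed (h : (G.addLoops Sp).FinDim) : (G.relaxed Sp).FinDim := by
  obtain ⟨M, hM⟩ := h
  refine ⟨M, fun p hp => ?_⟩
  cases p with
  | nil => simp
  | cons a l =>
    obtain ⟨l', hl', hlen⟩ := exists_addLoops_path hp
    exact (Nat.succ_le_succ hlen).trans (hM _ hl')

lemma MeshSwap.map_eq {p q : List (G.hatA Sp)} (h : G.MeshSwap Sp p q) :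
    p.map (G.arrowBelow Sp) = q.map (G.arrowBelow Sp) := by
  obtain ⟨l₁, l₂, u, v, u', v', rfl, rfl, hu, hv, -⟩ := h
  simp [arrowBelow, hu, hv]

lemma MeshSwap.cons {p q : List (G.hatA Sp)} (u : G.hatA Sp) (h : G.MeshSwap Sp p q) :
    G.MeshSwap Sp (u :: p) (u :: q) := by
  obtain ⟨l₁, l₂, v, w, v', w', rfl, rfl, h⟩ := h
  exact ⟨u :: l₁, l₂, v, w, v', w', rfl, rfl, h⟩

lemma map_eq_of_eqvGen {p q : List (G.hatA Sp)} (h : Relation.EqvGen (G.MeshSwap Sp) p q) :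
    p.map (G.arrowBelow Sp) = q.map (G.arrowBelow Sp) := by
  induction h with
  | rel _ _ h => exact h.map_eq
  | refl => rfl
  | symm _ _ _ ih => exact ih.symm
  | trans _ _ _ _ _ ih1 ih2 => exact ih1.trans ih2

lemma eqvGen_cons {p q : List (G.hatA Sp)} (u : G.hatA Sp)
    (h : Relation.EqvGen (G.MeshSwap Sp) p q) :
    Relation.EqvGen (G.MeshSwap Sp) (u :: p) (u :: q) := by
  induction h with
  | rel _ _ h => exact .rel _ _ (h.cons u)
  | refl => exact .refl _
  | symm _ _ _ ih => exact .symm _ _ ih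
  | trans _ _ _ _ _ ih1 ih2 => exact .trans _ _ _ ih1 ih2

lemma isNonzeroPathFrom_map {i j : (G.hatQuiv Sp).V} {p : List (G.hatA Sp)}
    (h : (G.hatQuiv Sp).IsNonzeroPathFrom i j p) :
    (G.relaxed Sp).IsNonzeroPathFrom (G.vertexBelow Sp i) (G.vertexBelow Sp j)
      (p.map (G.arrowBelow Sp)) := by
  induction p generalizing i with
  | nil =>
    obtain rfl := isNonzeroPathFrom_nil.1 h
    exact isNonzeroPathFrom_nil.2 rfl
  | cons u p ih =>
    obtain ⟨h1, h2, h3⟩ := isNonzeroPathFrom_cons.1 h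
    refine isNonzeroPathFrom_cons.2 ⟨h1 ▸ rfl, ?_, ih h3⟩
    cases p with
    | nil => simp
    | cons v p =>
      obtain ⟨h4, -, -⟩ := isNonzeroPathFrom_cons.1 h3
      rintro _ ⟨⟩ hr
      exact h2 v rfl ⟨hr.1, congrArg (fun x => x.1.2) h4.symm, hr.2⟩

lemma exists_lift {i j : (G.hatQuiv Sp).V} {p : List G.A}
    (h : (G.relaxed Sp).IsNonzeroPathFrom (G.vertexBelow Sp i) (G.vertexBelow Sp j) p)
    (hp : p ≠ []) :
    ∃ q : List (G.hatA Sp), q.map (G.arrowBelow Sp) = p ∧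
      (G.hatQuiv Sp).IsNonzeroPathFrom i j q := by
  induction p generalizing i with
  | nil => exact absurd rfl hp
  | cons a p ih =>
    obtain ⟨h1, h2, h3⟩ := isNonzeroPathFrom_cons.1 h
    have h1' : G.src a = i.1.1 := h1
    cases p with
    | nil =>
      have h3' : G.tgt a = j.1.1 := (isNonzeroPathFrom_nil (G := G.relaxed Sp)).1 h3
      refine ⟨[⟨(a, i.1.2, j.1.2), by rw [h1', h3']; exact ⟨i.2, j.2⟩⟩], rfl, ?_⟩
      exact isNonzeroPathFrom_cons.2 ⟨Subtype.ext (Prod.ext h1' rfl), nofun,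
        isNonzeroPathFrom_nil.2 (Subtype.ext (Prod.ext h3' rfl))⟩
    | cons b p =>
      obtain ⟨q, hq, hpath⟩ :=
        ih (i := (⟨(G.tgt a, false), fun _ => rfl⟩ : G.hatV Sp)) h3 (by simp)
      refine ⟨⟨(a, i.1.2, false), by rw [h1']; exact ⟨i.2, fun _ => rfl⟩⟩ :: q,
        by rw [List.map_cons, hq]; rfl, ?_⟩
      refine isNonzeroPathFrom_cons.2 ⟨Subtype.ext (Prod.ext h1' rfl), ?_, hpath⟩
      cases q with
      | nil => exact nofun
      | cons v q =>
        rw [List.map_cons, List.cons.injEq] at hq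
        have hv : v.1.1 = b := hq.1
        rintro _ ⟨⟩ ⟨hr, -, hs⟩
        exact h2 b rfl ⟨hv ▸ hr, hs⟩

lemma eqvGen_of_map_eq (hSp : (G.addLoops Sp).Gentle) {i j : (G.hatQuiv Sp).V}
    {p q : List (G.hatA Sp)} (hp : (G.hatQuiv Sp).IsNonzeroPathFrom i j p)
    (hq : (G.hatQuiv Sp).IsNonzeroPathFrom i j q)
    (h : p.map (G.arrowBelow Sp) = q.map (G.arrowBelow Sp)) :
    Relation.EqvGen (G.MeshSwap Sp) p q := by
  induction hn : p.length generalizing i p q with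
  | zero =>
    obtain rfl := List.length_eq_zero_iff.1 hn
    rw [List.map_nil, eq_comm, List.map_eq_nil_iff] at h
    rw [h]
    exact .refl _
  | succ n ih =>
    obtain ⟨u, p, rfl⟩ := List.exists_cons_of_length_eq_add_one hn
    cases q with
    | nil => simp at h
    | cons u' q =>
    rw [List.map_cons, List.map_cons, List.cons.injEq] at h
    obtain ⟨hu, hmap⟩ := h
    have hu : u.1.1 = u'.1.1 := hu
    rw [List.length_cons, Nat.add_right_cancel_iff] at hn
    obtain ⟨hp1, -, hp3⟩ := isNonzeroPathFrom_cons.1 hp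
    obtain ⟨hq1, -, hq3⟩ := isNonzeroPathFrom_cons.1 hq
    have hsrc : u.1.2.1 = u'.1.2.1 := congrArg (fun x => x.1.2) (hp1.trans hq1.symm)
    by_cases hs : u.1.2.2 = u'.1.2.2
    · obtain rfl : u = u' := Subtype.ext (Prod.ext hu (Prod.ext hsrc hs))
      exact eqvGen_cons u (ih hp3 hq3 hmap hn)
    · have hmem : G.tgt u.1.1 ∈ Sp := by
        by_contra hcon
        exact hs ((u.2.2 hcon).trans (u'.2.2 (hu ▸ hcon)).symm)
      cases p with
      | nil =>
        rw [List.map_nil, eq_comm, List.map_eq_nil_iff] at hmap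
        subst hmap
        exact absurd (congrArg (fun x => x.1.2)
          ((isNonzeroPathFrom_nil.1 hp3).trans (isNonzeroPathFrom_nil.1 hq3).symm)) hs
      | cons v p =>
        obtain ⟨hv1, hv2, hv3⟩ := isNonzeroPathFrom_cons.1 hp3
        have hcomp : G.src v.1.1 = G.tgt u.1.1 := congrArg (fun x => x.1.1) hv1
        have hsign : v.1.2.1 = u.1.2.2 := congrArg (fun x => x.1.2) hv1
        let v' : G.hatA Sp :=
          ⟨(v.1.1, u'.1.2.2, v.1.2.2), fun hcon => absurd (hcomp ▸ hmem) hcon, v.2.2⟩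
        have hswap : G.MeshSwap Sp (u :: v :: p) (u' :: v' :: p) :=
          ⟨[], p, u, v, u', v', rfl, rfl, hu, rfl, hsrc, rfl, hsign.symm, rfl,
            rel_of_mem_special hSp hcomp.symm hmem, hmem⟩
        refine .trans _ _ _ (.rel _ _ hswap) (eqvGen_cons u' (ih ?_ hq3 hmap hn))
        exact isNonzeroPathFrom_cons.2
          ⟨Subtype.ext (Prod.ext (hcomp.trans (congrArg G.tgt hu)) rfl), hv2, hv3⟩

/-- Mesh classes of nonzero paths of `Q̂` correspond to nonzero paths of the relaxed quiver. -/
lemma card_meshClasses (hSp : (G.addLoops Sp).Gentle) (i j : (G.hatQuiv Sp).V) (E : ℕ → Prop)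
    {P : List (G.hatA Sp) → Prop}
    (hP : ∀ p, P p ↔ E p.length ∧ (G.hatQuiv Sp).IsNonzeroPathFrom i j p) :
    Nat.card (Quotient (G.meshSetoid Sp P)) = Nat.card {p : List G.A // E p.length ∧
      (G.relaxed Sp).IsNonzeroPathFrom (G.vertexBelow Sp i) (G.vertexBelow Sp j) p ∧
        (p = [] → i = j)} := by
  refine Nat.card_congr (Equiv.ofBijective (Quotient.lift
    (fun p => ⟨p.1.map (G.arrowBelow Sp), ?_, ?_, ?_⟩) ?_) ⟨?_, ?_⟩)
  · rw [List.length_map]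
    exact ((hP _).1 p.2).1
  · exact isNonzeroPathFrom_map ((hP _).1 p.2).2
  · intro h
    exact ((hP _).1 p.2).2.2.2.2 (List.map_eq_nil_iff.1 h)
  · intro p q hpq
    exact Subtype.ext (map_eq_of_eqvGen hpq)
  · intro x y
    induction x using Quotient.inductionOn with
    | h p =>
    induction y using Quotient.inductionOn with
    | h q =>
      intro h
      exact Quotient.sound (eqvGen_of_map_eq hSp ((hP _).1 p.2).2 ((hP _).1 q.2).2
        (congrArg Subtype.val h))
  · rintro ⟨p, hE, hpath, hnil⟩
    by_cases hp : p = []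
    · subst hp
      exact ⟨Quotient.mk _ ⟨[], (hP _).2 ⟨hE, isNonzeroPathFrom_nil.2 (hnil rfl)⟩⟩, rfl⟩
    · obtain ⟨q, rfl, hq⟩ := exists_lift hpath hp
      rw [List.length_map] at hE
      exact ⟨Quotient.mk _ ⟨q, (hP _).2 ⟨hE, hq⟩⟩, rfl⟩

lemma hatQCartan_eq_pullbackQCartan (hSp : (G.addLoops Sp).Gentle) :
    G.hatQCartan Sp = (G.relaxed Sp).pullbackQCartan (G.vertexBelow Sp) := by
  ext1 i j
  refine finsum_congr fun n => ?_
  rw [card_meshClasses hSp i j (· = n) fun p => Iff.rfl]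

lemma hatCartan_eq_map_eval (hSp : (G.addLoops Sp).Gentle) (hfd : (G.addLoops Sp).FinDim) :
    G.hatCartan Sp = (evalRingHom (1 : ℤ)).mapMatrix (G.hatQCartan Sp) := by
  ext1 i j
  rw [hatQCartan_eq_pullbackQCartan hSp, RingHom.mapMatrix_apply, Matrix.map_apply,
    coe_evalRingHom, eval_one_pullbackQCartan (finDim_relaxed hfd), hatCartan,
    card_meshClasses hSp i j (fun _ => True) fun p => by rw [true_and]]
  simp only [true_and]

lemma cartan_eq_map_eval (hfd : G.FinDim) :
    G.cartan = (evalRingHom (1 : ℤ)).mapMatrix G.qCartan := by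
  ext1 i j
  rw [qCartan_eq_pullbackQCartan, RingHom.mapMatrix_apply, Matrix.map_apply,
    coe_evalRingHom, eval_one_pullbackQCartan hfd, cartan]
  simp only [id, isNonzeroPathFrom_and_nil_iff]

lemma card_vertices_above (v : G.V) :
    Nat.card {x : (G.hatQuiv Sp).V // v = G.vertexBelow Sp x} = if v ∈ Sp then 2 else 1 := by
  split_ifs with hv
  · rw [← Nat.card_eq_two_iff.2 ⟨false, true, by simp, by ext b; cases b <;> simp⟩]
    exact Nat.card_congr
      { toFun := fun x => x.1.1.2
        invFun := fun b => ⟨⟨(v, b), fun h => absurd hv h⟩, rfl⟩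
        left_inv := fun x => Subtype.ext (Subtype.ext (Prod.ext x.2 rfl))
        right_inv := fun b => rfl }
  · have : Unique {x : (G.hatQuiv Sp).V // v = G.vertexBelow Sp x} :=
      { default := ⟨⟨(v, false), fun _ => rfl⟩, rfl⟩
        uniq := by
          rintro ⟨x, rfl⟩
          exact Subtype.ext (Subtype.ext (Prod.ext rfl (x.2 hv))) }
    exact Nat.card_unique

open Classical in
lemma det_hatQCartan (hSp : (G.addLoops Sp).Gentle) (hfd : (G.addLoops Sp).FinDim) :
    (G.hatQCartan Sp).det =
      (1 + Matrix.of fun a b => if G.rel a b then (X : ℤ[X]) else 0).det := by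
  rw [hatQCartan_eq_pullbackQCartan hSp, det_pullbackQCartan (finDim_relaxed hfd)]
  congr 2
  ext1 a b
  rw [Matrix.smul_apply, Matrix.sub_apply, tgtMatrix_mul_srcMatrix_apply]
  simp only [stepMatrix, Matrix.of_apply]
  by_cases h : G.tgt a = G.src b
  · have hcard : Nat.card {x : (G.hatQuiv Sp).V //
        G.tgt a = G.vertexBelow Sp x ∧ G.src b = G.vertexBelow Sp x} =
          if G.tgt a ∈ Sp then 2 else 1 := by
      simp only [← h, and_self]
      exact card_vertices_above _
    rw [hcard]
    by_cases hs : G.tgt a ∈ Sp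
    · have hr := rel_of_mem_special hSp h hs
      rw [if_pos hs, if_pos ⟨h, fun h' => h'.2 hs⟩, if_pos hr]
      norm_num
    · rw [if_neg hs]
      by_cases hr : G.rel a b
      · rw [if_neg (fun h' => h'.2 ⟨hr, hs⟩), if_pos hr]
        simp
      · rw [if_pos ⟨h, fun h' => hr h'.1⟩, if_neg hr]
        simp
  · have hr : ¬ G.rel a b := fun hr => h (G.rel_comp _ _ hr)
    have : IsEmpty {x : (G.hatQuiv Sp).V //
        G.tgt a = G.vertexBelow Sp x ∧ G.src b = G.vertexBelow Sp x} :=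
      ⟨fun x => h (x.2.1.trans x.2.2.symm)⟩
    simp [h, hr]

end SkewedGentle

end QuivRel

/-- **Corollary 4.** Let `Â = KQ̂/Î` be a skewed-gentle algebra arising from an
admissible set `Sp` of special vertices of the gentle quiver `(Q,I)`, with
corresponding gentle algebra `A = KQ/I`.  Then
`det C_Â(q) = det C_A(q) = ∏_{k ≥ 1} (1 - (-q)^k)^{c_k}`, where `c_k` is the
number of minimal oriented `k`-cycles of `Q` with full zero relations; in
particular (specializing `q = 1`) the determinants of the ordinary Cartan
matrices coincide: `det C_Â = det C_A`. -/
theorem hatQCartan_det (G : QuivRel) (hG : G.Gentle) (hfd : G.FinDim)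
    (Sp : Finset G.V) (hSp : (G.addLoops Sp).Gentle ∧ (G.addLoops Sp).FinDim) :
    (G.hatQCartan Sp).det = G.qCartan.det ∧
    G.qCartan.det = ∏ᶠ k : ℕ, (1 - (- Polynomial.X) ^ (k + 1)) ^ G.numCycles (k + 1) ∧
    (G.hatCartan Sp).det = G.cartan.det := by
  have hdet : (G.hatQCartan Sp).det = G.qCartan.det :=
    (QuivRel.det_hatQCartan hSp.1 hSp.2).trans (QuivRel.det_qCartan hfd).symm
  refine ⟨hdet, (QuivRel.det_qCartan hfd).trans (QuivRel.det_one_add_rel hG), ?_⟩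
  rw [QuivRel.hatCartan_eq_map_eval hSp.1 hSp.2, QuivRel.cartan_eq_map_eval hfd,
    ← RingHom.map_det, ← RingHom.map_det, hdet]
end

section
/- Let (Q,I) be a gentle quiver with set of vertices Q_0 such that KQ/I is finite-dimensional. Then the total number of minimal oriented cycles in Q with full zero relations is at most |Q_0|. -/
namespace QuivRel

variable {G : QuivRel}

/-- A nonempty set of arrows in which every arrow has a nonzero continuation
yields arbitrarily long nonzero paths. -/
theorem not_finDim_of_forall_exists {S : Set G.A} (hne : S.Nonempty)
    (hS : ∀ a ∈ S, ∃ b ∈ S, G.tgt a = G.src b ∧ ¬ G.rel a b) : ¬ G.FinDim := by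
  rintro ⟨N, hN⟩
  have key : ∀ n : ℕ, ∀ a ∈ S, ∃ p : List G.A, G.IsNonzeroPath (a :: p) ∧ p.length = n := by
    intro n
    induction n with
    | zero => exact fun a _ => ⟨[], List.isChain_singleton a, rfl⟩
    | succ n ih =>
      intro a ha
      obtain ⟨b, hb, hab⟩ := hS a ha
      obtain ⟨p, hp, hlen⟩ := ih b hb
      exact ⟨b :: p, List.isChain_cons_cons.mpr ⟨hab, hp⟩, by simp [hlen]⟩
  obtain ⟨a, ha⟩ := hne
  obtain ⟨p, hp, hlen⟩ := key N a ha
  have := hN _ hp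
  simp only [List.length_cons] at this
  omega

theorem IsZeroCycle.length_pos {p : List G.A} (hp : G.IsZeroCycle p) : 0 < p.length :=
  List.length_pos_iff.mpr hp.1

theorem IsZeroCycle.rel_getElem {p : List G.A} (hp : G.IsZeroCycle p) (k : ℕ) :
    G.rel (p[k % p.length]'(Nat.mod_lt _ hp.length_pos))
      (p[(k + 1) % p.length]'(Nat.mod_lt _ hp.length_pos)) := by
  have h := hp.2 ⟨k % p.length, Nat.mod_lt _ hp.length_pos⟩
  simpa using h

theorem IsZeroCycle.exists_rel {p : List G.A} (hp : G.IsZeroCycle p) {a : G.A} (ha : a ∈ p) :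
    ∃ b ∈ p, G.rel a b := by
  obtain ⟨i, hi, rfl⟩ := List.getElem_of_mem ha
  exact ⟨_, List.getElem_mem _, hp.2 ⟨i, hi⟩⟩

/-- If relations have unique continuations, two zero cycles through the same
arrow agree from there on. -/
theorem IsZeroCycle.getElem_add_eq
    (huniq : ∀ a b c : G.A, G.rel a b → G.rel a c → b = c)
    {p q : List G.A} (hp : G.IsZeroCycle p) (hq : G.IsZeroCycle q) {i j : ℕ}
    (h : p[i % p.length]'(Nat.mod_lt _ hp.length_pos) =
      q[j % q.length]'(Nat.mod_lt _ hq.length_pos)) (k : ℕ) :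
    p[(i + k) % p.length]'(Nat.mod_lt _ hp.length_pos) =
      q[(j + k) % q.length]'(Nat.mod_lt _ hq.length_pos) := by
  induction k with
  | zero => exact h
  | succ k ih =>
    have h₁ := hp.rel_getElem (i + k)
    rw [ih] at h₁
    exact huniq _ _ _ h₁ (hq.rel_getElem (j + k))

theorem IsMinZeroCycle.length_dvd
    (huniq : ∀ a b c : G.A, G.rel a b → G.rel a c → b = c)
    {p q : List G.A} (hp : G.IsMinZeroCycle p) (hq : G.IsMinZeroCycle q) {i j : ℕ}
    (h : p[i % p.length]'(Nat.mod_lt _ hp.1.length_pos) =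
      q[j % q.length]'(Nat.mod_lt _ hq.1.length_pos)) : q.length ∣ p.length := by
  have h₁ := hp.1.getElem_add_eq huniq hq.1 h p.length
  simp only [Nat.add_mod_right] at h₁
  have h₂ : j % q.length = (j + p.length) % q.length :=
    (hq.2.getElem_inj_iff).mp (h.symm.trans h₁)
  have h₃ : j + 0 ≡ j + p.length [MOD q.length] := h₂
  exact (Nat.modEq_zero_iff_dvd.mp (Nat.ModEq.add_left_cancel' j h₃).symm)

/-- If relations have unique continuations, an arrow lies on at most one minimal
zero cycle, up to rotation. -/
theorem IsMinZeroCycle.isRotated_of_mem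
    (huniq : ∀ a b c : G.A, G.rel a b → G.rel a c → b = c)
    {p q : List G.A} (hp : G.IsMinZeroCycle p) (hq : G.IsMinZeroCycle q) {a : G.A}
    (hap : a ∈ p) (haq : a ∈ q) : p ~r q := by
  obtain ⟨i, hi, hpi⟩ := List.getElem_of_mem hap
  obtain ⟨j, hj, hqj⟩ := List.getElem_of_mem haq
  have h : p[i % p.length]'(Nat.mod_lt _ hp.1.length_pos) =
      q[j % q.length]'(Nat.mod_lt _ hq.1.length_pos) := by
    simp only [Nat.mod_eq_of_lt hi, Nat.mod_eq_of_lt hj, hpi, hqj]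
  have hlen : p.length = q.length :=
    Nat.dvd_antisymm (hq.length_dvd huniq hp h.symm) (hp.length_dvd huniq hq h)
  have hrot : p.rotate i = q.rotate j := by
    refine List.ext_getElem (by simp [hlen]) fun k _ _ => ?_
    simp only [List.getElem_rotate]
    have := hp.1.getElem_add_eq huniq hq.1 h k
    simpa only [Nat.add_comm] using this
  exact (List.IsRotated.forall p i).symm.trans (hrot ▸ List.IsRotated.forall q j)

end QuivRel

/-- Let `(Q,I)` be a gentle quiver such that `KQ/I` is finite-dimensional.
Then the total number of minimal oriented cycles in `Q` with full zero
relations is at most the number `|Q_0|` of vertices. -/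
theorem totalCycles_le_card_vertices (G : QuivRel) (hG : G.Gentle) (hfd : G.FinDim) :
    G.totalCycles ≤ Fintype.card G.V := by
  classical
  have huniq := hG.2.1
  unfold QuivRel.totalCycles
  set C := Quotient (G.cycleSetoid (fun p => G.IsMinZeroCycle p))
  rcases finite_or_infinite C with hfin | hinf
  swap
  · simp
  have := Fintype.ofFinite C
  have hmem : ∀ (c d : C) (a : G.A), a ∈ c.out.1 → a ∈ d.out.1 → c = d := by
    intro c d a hc hd
    rw [← Quotient.out_eq c, ← Quotient.out_eq d]
    exact Quotient.sound (c.out.2.isRotated_of_mem huniq d.out.2 hc hd)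
  -- The incidence matrix of vertices and cycles has trivial kernel.
  let M : Matrix G.V C ℚ :=
    fun v c => ∑ a : G.A, if G.src a = v ∧ a ∈ c.out.1 then 1 else 0
  have hinj : Function.Injective M.mulVecLin := by
    rw [injective_iff_map_eq_zero]
    intro x hx
    by_contra hx0
    obtain ⟨c, hc⟩ := Function.ne_iff.mp hx0
    have hsum : ∀ v, ∑ i : C × G.A, (if G.src i.2 = v ∧ i.2 ∈ i.1.out.1 then x i.1 else 0) = 0 := by
      intro v
      have hv : M.mulVec x v = 0 := congrFun hx v
      simp only [M, Matrix.mulVec, dotProduct, Finset.sum_mul, ite_mul, one_mul, zero_mul] at hv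
      rwa [Fintype.sum_prod_type]
    refine QuivRel.not_finDim_of_forall_exists
      (S := {a | ∃ c : C, x c ≠ 0 ∧ a ∈ c.out.1}) ?_ ?_ hfd
    · obtain ⟨a, ha⟩ := List.exists_mem_of_ne_nil _ c.out.2.1.1
      exact ⟨a, c, hc, ha⟩
    · rintro a ⟨d, hd, had⟩
      obtain ⟨b, hbd, hab⟩ := d.out.2.1.exists_rel had
      by_contra! hno
      have hs := hsum (G.tgt a)
      rw [Finset.sum_eq_single (d, b)] at hs
      · exact hd (by simpa [G.rel_comp a b hab, hbd] using hs)
      · rintro ⟨e, b'⟩ - hne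
        by_contra hterm
        obtain ⟨⟨hsrc, hmem'⟩, hxe⟩ := ite_ne_right_iff.mp hterm
        obtain rfl := huniq a b b' hab (hno b' ⟨e, hxe, hmem'⟩ hsrc.symm)
        exact hne (by rw [hmem e d b hmem' hbd])
      · simp
  rw [Nat.card_eq_fintype_card]
  simpa using LinearMap.finrank_le_finrank_of_injective hinj
end
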